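/- arXiv:2112.03832 — 3 statements merged into one kernel-verified Lean document; each statement's English description precedes it below -/
import Mathlib

section
/- Let n ≥ 1. For every f ∈ L^1_loc(ℝ^n) and every family (f_ε)_{ε>0} ⊂ L^1_loc(ℝ^n) such that f_ε → f in L^1_loc(ℝ^n) as ε → 0, one has (1/4)·|Df|(ℝ^n) ≤ liminf_{ε→0} K_ε(f_ε). -/
open MeasureTheory Filter Topology ENNReal

noncomputable section

/-- The standard open cube `(0, ε)^n` in `ℝ^n`. -/
def stdCube (n : ℕ) (ε : ℝ) : Set (EuclideanSpace ℝ (Fin n)) :=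
  {x | ∀ i, x i ∈ Set.Ioo (0 : ℝ) ε}

/-- `Q ⊆ ℝ^n` is an `ε`-cube: the image of `(0,ε)^n` under a rigid motion of `ℝ^n`. -/
def IsCube (n : ℕ) (ε : ℝ) (Q : Set (EuclideanSpace ℝ (Fin n))) : Prop :=
  ∃ T : EuclideanSpace ℝ (Fin n) ≃ᵢ EuclideanSpace ℝ (Fin n), Q = T '' stdCube n ε

/-- The BMO-type energy `K_ε(f)`: the supremum, over all countable families `H` of pairwise
disjoint `ε`-cubes, of `ε^(n-1) * Σ_{Q ∈ H} ⨍_Q |f - ⨍_Q f|`, valued in `[0,∞]`. -/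
def K (n : ℕ) (ε : ℝ) (f : EuclideanSpace ℝ (Fin n) → ℝ) : ℝ≥0∞ :=
  ⨆ (H : Set (Set (EuclideanSpace ℝ (Fin n)))) (_ : H.Countable)
    (_ : ∀ Q ∈ H, IsCube n ε Q) (_ : H.Pairwise Disjoint),
    ENNReal.ofReal (ε ^ (n - 1)) *
      ∑' Q : H, ENNReal.ofReal (⨍ x in (Q : Set (EuclideanSpace ℝ (Fin n))),
        |f x - ⨍ y in (Q : Set (EuclideanSpace ℝ (Fin n))), f y|)

/-- The divergence of a vector field `φ : ℝ^n → ℝ^n`. -/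
def div' {n : ℕ} (φ : EuclideanSpace ℝ (Fin n) → EuclideanSpace ℝ (Fin n))
    (x : EuclideanSpace ℝ (Fin n)) : ℝ :=
  ∑ i, fderiv ℝ φ x (EuclideanSpace.single i 1) i

/-- The extended total variation `|Df|(ℝ^n)`, valued in `[0,∞]`. -/
def totalVariation (n : ℕ) (f : EuclideanSpace ℝ (Fin n) → ℝ) : ℝ≥0∞ :=
  ⨆ (φ : EuclideanSpace ℝ (Fin n) → EuclideanSpace ℝ (Fin n)) (_ : ContDiff ℝ 1 φ)
    (_ : HasCompactSupport φ) (_ : ∀ x, ‖φ x‖ ≤ 1),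
    ENNReal.ofReal (∫ x, f x * div' φ x)

local notation "𝔼" n:max => EuclideanSpace ℝ (Fin n)

section Cubes

open scoped Pointwise

variable {n : ℕ}

theorem isOpen_stdCube (n : ℕ) (ε : ℝ) : IsOpen (stdCube n ε) := by
  have : stdCube n ε = ⋂ i, (fun x : 𝔼 n => x i) ⁻¹' Set.Ioo 0 ε := by
    ext x; simp [stdCube]
  rw [this]
  exact isOpen_iInter_of_finite fun i => isOpen_Ioo.preimage (by fun_prop)

theorem stdCube_nonempty (n : ℕ) {ε : ℝ} (hε : 0 < ε) : (stdCube n ε).Nonempty :=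
  ⟨WithLp.toLp 2 fun _ => ε / 2, fun _ => ⟨by simpa using hε, by simpa using hε⟩⟩

theorem norm_le_of_mem_stdCube {ε : ℝ} {v : 𝔼 n} (hv : v ∈ stdCube n ε) :
    ‖v‖ ≤ n * ε := by
  calc ‖v‖ = ‖∑ i, v i • EuclideanSpace.single i (1 : ℝ)‖ := by
        congr 1
        ext j
        simp [Pi.single_apply]
    _ ≤ ∑ i : Fin n, ‖v i • EuclideanSpace.single i (1 : ℝ)‖ := norm_sum_le _ _
    _ ≤ ∑ _i : Fin n, ε := by
        refine Finset.sum_le_sum fun i _ => ?_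
        have := hv i
        rw [norm_smul, PiLp.norm_single, norm_one, mul_one, Real.norm_eq_abs, abs_of_pos this.1]
        exact this.2.le
    _ = n * ε := by simp

theorem volume_setOf_forall_mem_Ico (n : ℕ) {δ : ℝ} (hδ : 0 < δ) :
    volume {x : 𝔼 n | ∀ i, x i ∈ Set.Ico 0 δ} = ENNReal.ofReal (δ ^ n) := by
  have : {x : 𝔼 n | ∀ i, x i ∈ Set.Ico 0 δ} =
      (@WithLp.ofLp 2 (Fin n → ℝ)) ⁻¹' (Set.univ.pi fun _ => Set.Ico 0 δ) := by
    ext x; simp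
  rw [this, (PiLp.volume_preserving_ofLp (Fin n)).measure_preimage
    (MeasurableSet.univ_pi fun _ => measurableSet_Ico).nullMeasurableSet, volume_pi_pi]
  simp [ENNReal.ofReal_pow hδ.le]

theorem volume_stdCube (n : ℕ) {δ : ℝ} (hδ : 0 < δ) :
    volume (stdCube n δ) = ENNReal.ofReal (δ ^ n) := by
  have : stdCube n δ =
      (@WithLp.ofLp 2 (Fin n → ℝ)) ⁻¹' (Set.univ.pi fun _ => Set.Ioo 0 δ) := by
    ext x; simp [stdCube]
  rw [this, (PiLp.volume_preserving_ofLp (Fin n)).measure_preimage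
    (MeasurableSet.univ_pi fun _ => measurableSet_Ioo).nullMeasurableSet, volume_pi_pi]
  simp [ENNReal.ofReal_pow hδ.le]

instance isProbabilityMeasure_restrict_stdCube_one :
    IsProbabilityMeasure (volume.restrict (stdCube n 1)) :=
  ⟨by simp [volume_stdCube n one_pos]⟩

theorem smul_stdCube_one {ε : ℝ} (hε : 0 < ε) : ε • stdCube n 1 = stdCube n ε := by
  ext x
  rw [Set.mem_smul_set_iff_inv_smul_mem₀ hε.ne']
  simp only [stdCube, Set.mem_ofPred_eq, PiLp.smul_apply, smul_eq_mul, Set.mem_Ioo]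
  refine forall_congr' fun i => and_congr ?_ ?_
  · rw [mul_pos_iff_of_pos_left (inv_pos.2 hε)]
  · rw [inv_mul_lt_iff₀ hε, mul_one]

/-- The rigid motion `v ↦ z + R v`. -/
def rigidMotion (R : 𝔼 n ≃ₗᵢ[ℝ] 𝔼 n) (z : 𝔼 n) : 𝔼 n ≃ᵢ 𝔼 n :=
  R.toIsometryEquiv.trans (IsometryEquiv.addLeft z)

@[simp]
theorem rigidMotion_apply (R : 𝔼 n ≃ₗᵢ[ℝ] 𝔼 n) (z v : 𝔼 n) :
    rigidMotion R z v = z + R v := rfl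

theorem isCube_rigidMotion (R : 𝔼 n ≃ₗᵢ[ℝ] 𝔼 n) (z : 𝔼 n) (ε : ℝ) :
    IsCube n ε (rigidMotion R z '' stdCube n ε) :=
  ⟨_, rfl⟩

theorem measurePreserving_rigidMotion (R : 𝔼 n ≃ₗᵢ[ℝ] 𝔼 n) (z : 𝔼 n) :
    MeasurePreserving (rigidMotion R z) volume volume :=
  (measurePreserving_add_left volume z).comp R.measurePreserving

theorem setAverage_rigidMotion (R : 𝔼 n ≃ₗᵢ[ℝ] 𝔼 n) (z : 𝔼 n) {ε : ℝ} (hε : 0 < ε)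
    (G : 𝔼 n → ℝ) :
    ⨍ x in rigidMotion R z '' stdCube n ε, G x = ∫ v in stdCube n 1, G (z + ε • R v) := by
  have hemb : MeasurableEmbedding (rigidMotion R z) :=
    (rigidMotion R z).toHomeomorph.measurableEmbedding
  have hmp := measurePreserving_rigidMotion R z
  have hvol : volume (rigidMotion R z '' stdCube n ε) = ENNReal.ofReal (ε ^ n) := by
    rw [← volume_stdCube n hε, ← hmp.measure_preimage_emb hemb,
      Set.preimage_image_eq _ (rigidMotion R z).injective]
  have h := Measure.setIntegral_comp_smul_of_pos (volume : Measure (𝔼 n))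
    (fun w => G (z + R w)) (stdCube n 1) hε
  rw [smul_stdCube_one hε] at h
  rw [setAverage_eq, hmp.setIntegral_image_emb hemb, Measure.real, hvol,
    ENNReal.toReal_ofReal (by positivity)]
  simpa using h.symm

theorem K_ge_tsum {ε : ℝ} (hε : 0 < ε) (g : 𝔼 n → ℝ) {ι : Type*} [Countable ι]
    (Q : ι → Set (𝔼 n)) (hQ : ∀ i, IsCube n ε (Q i)) (hd : Pairwise (Function.onFun Disjoint Q)) :
    ENNReal.ofReal (ε ^ (n - 1)) *
      ∑' i, ENNReal.ofReal (⨍ x in Q i, |g x - ⨍ y in Q i, g y|) ≤ K n ε g := by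
  have hne : ∀ i, (Q i).Nonempty := fun i => by
    obtain ⟨T, hT⟩ := hQ i
    rw [hT]
    exact (stdCube_nonempty n hε).image _
  have hinj : Function.Injective Q := by
    intro i j hij
    by_contra h
    have := hd h
    simp only [Function.onFun, hij, disjoint_self] at this
    exact (hne j).ne_empty this
  rw [← tsum_range (g := Q)
    (fun s : Set (𝔼 n) => ENNReal.ofReal (⨍ x in s, |g x - ⨍ y in s, g y|)) hinj]
  unfold K
  refine le_iSup_of_le (Set.range Q) (le_iSup_of_le (Set.countable_range Q)
    (le_iSup_of_le ?_ (le_iSup_of_le ?_ le_rfl)))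
  · rintro _ ⟨i, rfl⟩
    exact hQ i
  · rintro _ ⟨i, rfl⟩ _ ⟨j, rfl⟩ hij
    exact hd fun h => hij (h ▸ rfl)

end Cubes

section Lattice

variable {n : ℕ}

/-- The point of the lattice `δ ℤ^n` with coordinates `δ k`. -/
def latticePoint (δ : ℝ) (k : Fin n → ℤ) : 𝔼 n := WithLp.toLp 2 fun i => δ * k i

@[simp]
theorem latticePoint_apply (δ : ℝ) (k : Fin n → ℤ) (i : Fin n) :
    latticePoint δ k i = δ * k i := rfl

/-- If all sums of `F` over translates of the lattice `δ ℤ^n` are bounded by `B`, then the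
integral of `F` is at most `δ^n B`. -/
theorem lintegral_le_of_forall_tsum_latticePoint_le {δ : ℝ} (hδ : 0 < δ) {F : 𝔼 n → ℝ≥0∞}
    (hF : AEMeasurable F) {B : ℝ≥0∞}
    (hB : ∀ t, ∑' k : Fin n → ℤ, F (t + latticePoint δ k) ≤ B) :
    ∫⁻ x, F x ≤ ENNReal.ofReal (δ ^ n) * B := by
  set D : Set (𝔼 n) := {x | ∀ i, x i ∈ Set.Ico 0 δ} with hD
  have hDm : MeasurableSet D := by
    have : D = ⋂ i, (fun x : 𝔼 n => x i) ⁻¹' Set.Ico 0 δ := by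
      ext x; simp [hD]
    rw [this]
    exact MeasurableSet.iInter fun i => measurableSet_Ico.preimage (by fun_prop)
  set S : (Fin n → ℤ) → Set (𝔼 n) := fun k => (fun x => x + latticePoint δ k) '' D with hS
  have hemb : ∀ k, MeasurableEmbedding (fun x : 𝔼 n => x + latticePoint δ k) :=
    fun k => measurableEmbedding_addRight _
  have hmem : ∀ k x, x ∈ S k ↔ ∀ i, k i = ⌊x i / δ⌋ := by
    intro k x
    simp only [hS, Set.image_add_right, Set.mem_preimage, hD, Set.mem_ofPred_eq, PiLp.add_apply,
      PiLp.neg_apply, latticePoint_apply, Set.mem_Ico]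
    refine forall_congr' fun i => ?_
    rw [eq_comm, Int.floor_eq_iff, le_div_iff₀ hδ, div_lt_iff₀ hδ]
    constructor <;> rintro ⟨h1, h2⟩ <;> constructor <;> nlinarith
  have hU : ⋃ k, S k = Set.univ := by
    refine Set.eq_univ_of_forall fun x => Set.mem_iUnion.2 ⟨fun i => ⌊x i / δ⌋, ?_⟩
    rw [hmem]
    exact fun _ => rfl
  have hdisj : Pairwise (Function.onFun Disjoint S) := by
    intro k l hkl
    refine Set.disjoint_left.2 fun x hk hl => hkl ?_
    rw [hmem] at hk hl
    ext i
    rw [hk, hl]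
  have hmp : ∀ k, MeasurePreserving (fun x : 𝔼 n => x + latticePoint δ k) volume volume :=
    fun k => measurePreserving_add_right _ _
  calc ∫⁻ x, F x = ∫⁻ x in ⋃ k, S k, F x := by rw [hU, setLIntegral_univ]
    _ = ∑' k, ∫⁻ x in S k, F x :=
        lintegral_iUnion (fun k => (hemb k).measurableSet_image' hDm) hdisj F
    _ = ∑' k, ∫⁻ x in D, F (x + latticePoint δ k) := by
        congr 1 with k
        exact ((hmp k).setLIntegral_comp_emb (hemb k) F D).symm
    _ = ∫⁻ x in D, ∑' k, F (x + latticePoint δ k) := by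
        refine (lintegral_tsum fun k => ?_).symm
        exact (hF.comp_quasiMeasurePreserving (hmp k).quasiMeasurePreserving).restrict
    _ ≤ ∫⁻ _ in D, B := lintegral_mono fun x => hB x
    _ = ENNReal.ofReal (δ ^ n) * B := by
        rw [setLIntegral_const, volume_setOf_forall_mem_Ico n hδ, mul_comm]

theorem disjoint_image_stdCube_latticePoint {δ : ℝ} (hδ : 0 < δ) (t : 𝔼 n)
    {k l : Fin n → ℤ} (hkl : k ≠ l) :
    Disjoint ((fun v => t + latticePoint δ k + v) '' stdCube n δ)
      ((fun v => t + latticePoint δ l + v) '' stdCube n δ) := by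
  refine Set.disjoint_left.2 ?_
  rintro _ ⟨v, hv, rfl⟩ ⟨w, hw, hvw⟩
  refine hkl (funext fun i => ?_)
  have h : t i + δ * l i + w i = t i + δ * k i + v i := by
    simpa using congrArg (fun x : 𝔼 n => x i) hvw
  have h1 := hv i
  have h2 := hw i
  simp only [Set.mem_Ioo] at h1 h2
  have h3 : ((k i : ℝ) - l i) < 1 := by nlinarith
  have h4 : ((l i : ℝ) - k i) < 1 := by nlinarith
  have h5 : k i - l i < 1 := by exact_mod_cast h3
  have h6 : l i - k i < 1 := by exact_mod_cast h4
  omega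

end Lattice

section HalfSign

variable {n : ℕ}

/-- The function on the unit cube equal to `-1` on the half `v i < 1/2` and to `1` on the other
half. -/
def halfSign (i : Fin n) (v : 𝔼 n) : ℝ := if v i < 1 / 2 then -1 else 1

theorem measurable_halfSign (i : Fin n) : Measurable (halfSign i) :=
  Measurable.ite (measurableSet_lt (by fun_prop) measurable_const) measurable_const measurable_const

theorem abs_halfSign (i : Fin n) (v : 𝔼 n) : |halfSign i v| = 1 := by
  unfold halfSign
  split_ifs <;> simp

theorem integrableOn_halfSign (i : Fin n) : IntegrableOn (halfSign i) (stdCube n 1) :=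
  (integrable_const (1 : ℝ)).mono' (measurable_halfSign i).aestronglyMeasurable
    (ae_of_all _ fun v => (abs_halfSign i v).le)

theorem setIntegral_Ioo_halfSign_mul {q : ℝ → ℝ} (hq : Continuous q) :
    ∫ t in Set.Ioo (0 : ℝ) 1, (if t < 1 / 2 then -1 else 1) * q t =
      (∫ t in (1 / 2)..1, q t) - ∫ t in 0..(1 / 2), q t := by
  set s : ℝ → ℝ := fun t => (if t < 1 / 2 then -1 else 1) * q t with hs
  have e1 : Set.EqOn s (fun t => -q t) (Set.Ioo 0 (1 / 2)) := fun t ht => by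
    simp only [hs, if_pos ht.2, neg_one_mul]
  have e2 : Set.EqOn s q (Set.Ioo (1 / 2) 1) := fun t ht => by
    simp only [hs, if_neg (not_lt.2 ht.1.le), one_mul]
  have h1 : ∫ t in (0 : ℝ)..(1 / 2), s t = -∫ t in 0..(1 / 2), q t := by
    rw [← intervalIntegral.integral_neg, intervalIntegral.integral_of_le (by norm_num),
      intervalIntegral.integral_of_le (by norm_num), integral_Ioc_eq_integral_Ioo,
      integral_Ioc_eq_integral_Ioo]
    exact setIntegral_congr_fun measurableSet_Ioo e1
  have h2 : ∫ t in (1 / 2 : ℝ)..1, s t = ∫ t in (1 / 2)..1, q t := by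
    rw [intervalIntegral.integral_of_le (by norm_num),
      intervalIntegral.integral_of_le (by norm_num), integral_Ioc_eq_integral_Ioo,
      integral_Ioc_eq_integral_Ioo]
    exact setIntegral_congr_fun measurableSet_Ioo e2
  have hm : Measurable fun t : ℝ => if t < 1 / 2 then (-1 : ℝ) else 1 :=
    Measurable.ite measurableSet_Iio measurable_const measurable_const
  have hi : ∀ a b : ℝ, IntervalIntegrable s volume a b := fun a b => by
    refine (hq.intervalIntegrable a b).mono_fun
      (hm.mul hq.measurable).aestronglyMeasurable (ae_of_all _ fun t => ?_)
    simp only [hs, norm_mul]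
    split_ifs <;> simp
  rw [← integral_Ioc_eq_integral_Ioo, ← intervalIntegral.integral_of_le (by norm_num),
    ← intervalIntegral.integral_add_adjacent_intervals (hi 0 (1 / 2)) (hi (1 / 2) 1), h1, h2]
  ring

theorem setIntegral_stdCube_one_prod (p : Fin n → ℝ → ℝ) :
    ∫ v in stdCube n 1, ∏ l, p l (v l) = ∏ l, ∫ t in Set.Ioo (0 : ℝ) 1, p l t := by
  have hpre : stdCube n 1 =
      (@WithLp.ofLp 2 (Fin n → ℝ)) ⁻¹' (Set.univ.pi fun _ => Set.Ioo 0 1) := by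
    ext x; simp [stdCube]
  rw [← integral_fintype_prod_eq_prod, ← Measure.restrict_pi_pi, hpre]
  exact (PiLp.volume_preserving_ofLp (Fin n)).setIntegral_preimage_emb
    (MeasurableEquiv.toLp 2 (Fin n → ℝ)).symm.measurableEmbedding
    (fun x : Fin n → ℝ => ∏ l, p l (x l)) _

theorem setIntegral_halfSign (i : Fin n) : ∫ v in stdCube n 1, halfSign i v = 0 := by
  have h : ∀ v : 𝔼 n, halfSign i v =
      ∏ l, (fun t : ℝ => if l = i then (if t < 1 / 2 then (-1 : ℝ) else 1) else 1) (v l) := by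
    intro v
    simp [halfSign]
  simp_rw [h]
  rw [setIntegral_stdCube_one_prod
    (fun l t => if l = i then (if t < 1 / 2 then (-1 : ℝ) else 1) else 1)]
  refine Finset.prod_eq_zero (Finset.mem_univ i) ?_
  have := setIntegral_Ioo_halfSign_mul (q := fun _ => 1) continuous_const
  simp only [mul_one] at this
  simp only [if_true, this]
  norm_num

theorem setIntegral_halfSign_mul (i j : Fin n) :
    ∫ v in stdCube n 1, halfSign i v * v j = if j = i then 1 / 4 else 0 := by
  have h : ∀ v : 𝔼 n, halfSign i v * v j =
      ∏ l, (fun t : ℝ => (if l = i then (if t < 1 / 2 then (-1 : ℝ) else 1) else 1) *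
        (if l = j then t else 1)) (v l) := by
    intro v
    simp only [Finset.prod_mul_distrib]
    simp only [Finset.prod_ite_eq', Finset.mem_univ, if_true, halfSign]
  simp_rw [h]
  rw [setIntegral_stdCube_one_prod
    (fun l t => (if l = i then (if t < 1 / 2 then (-1 : ℝ) else 1) else 1) *
        (if l = j then t else 1))]
  split_ifs with hij
  · subst hij
    rw [Finset.prod_eq_single j]
    · simp only [if_true]
      rw [setIntegral_Ioo_halfSign_mul continuous_id']
      simp only [integral_id]
      norm_num
    · intro l _ hl
      simp [hl]
    · simp
  · refine Finset.prod_eq_zero (Finset.mem_univ i) ?_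
    have := setIntegral_Ioo_halfSign_mul (q := fun _ => 1) continuous_const
    simp only [mul_one] at this
    simp only [if_true, if_neg (Ne.symm hij), mul_one, this]
    norm_num

theorem setIntegral_halfSign_smul (i : Fin n) :
    ∫ v in stdCube n 1, halfSign i v • v = (1 / 4 : ℝ) • EuclideanSpace.single i 1 := by
  have hInt : Integrable (fun v => halfSign i v • v) (volume.restrict (stdCube n 1)) := by
    refine (integrable_const ((n : ℝ) * 1)).mono'
      ((measurable_halfSign i).smul measurable_id).aestronglyMeasurable ?_
    filter_upwards [ae_restrict_mem (isOpen_stdCube n 1).measurableSet] with v hv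
    rw [norm_smul, Real.norm_eq_abs, abs_halfSign, one_mul]
    exact norm_le_of_mem_stdCube hv
  ext j
  have h := (EuclideanSpace.proj j : 𝔼 n →L[ℝ] ℝ).integral_comp_comm hInt
  simp only [PiLp.proj_apply, PiLp.smul_apply, smul_eq_mul] at h
  rw [← h, setIntegral_halfSign_mul]
  simp

theorem integrableOn_comp_add_smul {g : 𝔼 n → ℝ} (hg : LocallyIntegrable g)
    (R : 𝔼 n ≃ₗᵢ[ℝ] 𝔼 n) (z : 𝔼 n) {ε : ℝ} (hε : 0 < ε) :
    IntegrableOn (fun v => g (z + ε • R v)) (stdCube n 1) := by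
  have hemb : MeasurableEmbedding (rigidMotion R z) :=
    (rigidMotion R z).toHomeomorph.measurableEmbedding
  have hmp := measurePreserving_rigidMotion R z
  have h1 : IntegrableOn (fun w => g (z + R w)) (stdCube n ε) := by
    have : IntegrableOn g (rigidMotion R z '' stdCube n ε) := by
      refine (hg.integrableOn_isCompact (isCompact_closedBall z (n * ε))).mono_set ?_
      rintro _ ⟨v, hv, rfl⟩
      simpa using norm_le_of_mem_stdCube hv
    exact (hmp.integrableOn_image hemb).1 this
  rw [← integrable_indicator_iff (isOpen_stdCube n _).measurableSet] at h1 ⊢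
  refine ((integrable_comp_smul_iff volume _ hε.ne').2 h1).congr (ae_of_all _ fun v => ?_)
  have hv : ε • v ∈ stdCube n ε ↔ v ∈ stdCube n 1 := by
    rw [← smul_stdCube_one hε, Set.smul_mem_smul_set_iff₀ hε.ne']
  by_cases h : v ∈ stdCube n 1
  · simp [Set.indicator_of_mem h, Set.indicator_of_mem (hv.2 h)]
  · simp [Set.indicator_of_notMem h, Set.indicator_of_notMem (mt hv.1 h)]

theorem abs_setIntegral_halfSign_mul_le {g : 𝔼 n → ℝ} (hg : LocallyIntegrable g) (i : Fin n)
    (R : 𝔼 n ≃ₗᵢ[ℝ] 𝔼 n) (z : 𝔼 n) {ε : ℝ} (hε : 0 < ε) :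
    |∫ v in stdCube n 1, halfSign i v * g (z + ε • R v)| ≤
      ⨍ x in rigidMotion R z '' stdCube n ε,
        |g x - ⨍ y in rigidMotion R z '' stdCube n ε, g y| := by
  rw [setAverage_rigidMotion R z hε]
  set m := ⨍ y in rigidMotion R z '' stdCube n ε, g y
  have hInt := integrableOn_comp_add_smul hg R z hε
  have h1 : Integrable (fun v => halfSign i v * g (z + ε • R v))
      (volume.restrict (stdCube n 1)) :=
    hInt.bdd_mul (c := 1) (measurable_halfSign i).aestronglyMeasurable
      (ae_of_all _ fun v => (abs_halfSign i v).le)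
  have h2 : ∫ v in stdCube n 1, halfSign i v * g (z + ε • R v) =
      ∫ v in stdCube n 1, halfSign i v * (g (z + ε • R v) - m) := by
    simp_rw [mul_sub]
    rw [integral_sub h1 ((integrableOn_halfSign i).mul_const m), integral_mul_const,
      setIntegral_halfSign, zero_mul, sub_zero]
  rw [h2]
  refine abs_integral_le_integral_abs.trans_eq ?_
  simp_rw [abs_mul, abs_halfSign, one_mul]

end HalfSign

section FineScale

variable {n : ℕ}

theorem integrable_prod_mul_of_bounded {X : Type*} [MeasurableSpace X] {μ : Measure X}
    [IsFiniteMeasure μ] {f : 𝔼 n → ℝ} (hf : LocallyIntegrable f) {B : X × 𝔼 n → ℝ}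
    (hB : AEStronglyMeasurable B (μ.prod volume)) {M : ℝ} (hM : ∀ p, |B p| ≤ M)
    {C : Set (𝔼 n)} (hC : IsCompact C) (h0 : ∀ᵐ v ∂μ, ∀ y ∉ C, B (v, y) = 0) :
    Integrable (fun p : X × 𝔼 n => f p.2 * B p) (μ.prod volume) := by
  have h1 : Integrable (C.indicator f) :=
    (hf.integrableOn_isCompact hC).integrable_indicator hC.measurableSet
  refine ((h1.comp_snd μ).mul_bdd (c := M) hB (ae_of_all _ hM)).congr ?_
  filter_upwards [Measure.quasiMeasurePreserving_fst.ae h0] with p hp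
  by_cases h : p.2 ∈ C
  · simp [Set.indicator_of_mem h]
  · simp [hp p.2 h]

/-- The scaled average of `η (y - ε R v)` over the unit cube against `halfSign i v`. It
approximates `-(1/4)` times the derivative of `η` in the direction `R e_i`. -/
def cubeDiff (i : Fin n) (R : 𝔼 n ≃ₗᵢ[ℝ] 𝔼 n) (η : 𝔼 n → ℝ) (ε : ℝ) (y : 𝔼 n) : ℝ :=
  ε⁻¹ * ∫ v in stdCube n 1, halfSign i v * η (y - ε • R v)

theorem comp_sub_smul_eq_zero {η : 𝔼 n → ℝ} (R : 𝔼 n ≃ₗᵢ[ℝ] 𝔼 n) {ε : ℝ} (hε : 0 < ε)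
    (hε1 : ε ≤ 1) {v y : 𝔼 n} (hv : v ∈ stdCube n 1)
    (hy : y ∉ Metric.cthickening n (tsupport η)) : η (y - ε • R v) = 0 := by
  by_contra h
  refine hy (Metric.mem_cthickening_of_dist_le y (y - ε • R v) n _ (subset_tsupport _ h) ?_)
  rw [dist_eq_norm, _root_.sub_sub_cancel, norm_smul, Real.norm_eq_abs, abs_of_pos hε,
    LinearIsometryEquiv.norm_map]
  have := norm_le_of_mem_stdCube hv
  nlinarith [norm_nonneg v]

theorem measurePreserving_shear (R : 𝔼 n ≃ₗᵢ[ℝ] 𝔼 n) (ε : ℝ) (μ : Measure (𝔼 n)) [SFinite μ] :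
    MeasurePreserving (fun p : 𝔼 n × 𝔼 n => (p.1, p.2 + ε • R p.1))
      (μ.prod volume) (μ.prod volume) := by
  refine (MeasurePreserving.id μ).skew_product (g := fun v z : 𝔼 n => z + ε • R v) ?_
    (ae_of_all _ fun v => (measurePreserving_add_right _ _).map_eq)
  exact (Continuous.measurable (by unfold Function.uncurry; fun_prop))

section

variable {g : 𝔼 n → ℝ} {η : 𝔼 n → ℝ} {ε : ℝ}

theorem integrable_mul_halfSign_mul (hg : LocallyIntegrable g) (hη : Continuous η)
    (hηc : HasCompactSupport η) (i : Fin n) (R : 𝔼 n ≃ₗᵢ[ℝ] 𝔼 n) (hε : 0 < ε) (hε1 : ε ≤ 1) :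
    Integrable (fun p : 𝔼 n × 𝔼 n => g p.2 * (halfSign i p.1 * η (p.2 - ε • R p.1)))
      ((volume.restrict (stdCube n 1)).prod volume) := by
  obtain ⟨M, hM⟩ := hηc.exists_bound_of_continuous hη
  refine integrable_prod_mul_of_bounded hg (M := M) (Measurable.aestronglyMeasurable ?_) ?_
    (hηc.isCompact.cthickening (r := n)) ?_
  · have : Continuous fun p : 𝔼 n × 𝔼 n => η (p.2 - ε • R p.1) := by fun_prop
    exact ((measurable_halfSign i).comp measurable_fst).mul this.measurable
  · intro p
    rw [abs_mul, abs_halfSign, one_mul]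
    exact hM _
  · filter_upwards [ae_restrict_mem (isOpen_stdCube n 1).measurableSet] with v hv y hy
    rw [comp_sub_smul_eq_zero R hε hε1 hv hy, mul_zero]

theorem integrable_shear_halfSign_mul (hg : LocallyIntegrable g) (hη : Continuous η)
    (hηc : HasCompactSupport η) (i : Fin n) (R : 𝔼 n ≃ₗᵢ[ℝ] 𝔼 n) (hε : 0 < ε) (hε1 : ε ≤ 1) :
    Integrable (fun p : 𝔼 n × 𝔼 n => g (p.2 + ε • R p.1) * (halfSign i p.1 * η p.2))
      ((volume.restrict (stdCube n 1)).prod volume) := by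
  have := (measurePreserving_shear R ε (volume.restrict (stdCube n 1))).integrable_comp_of_integrable
    (integrable_mul_halfSign_mul hg hη hηc i R hε hε1)
  refine this.congr (ae_of_all _ fun p => ?_)
  simp

theorem integral_shear_halfSign_mul (hg : LocallyIntegrable g) (hη : Continuous η)
    (hηc : HasCompactSupport η) (i : Fin n) (R : 𝔼 n ≃ₗᵢ[ℝ] 𝔼 n) (hε : 0 < ε) (hε1 : ε ≤ 1) :
    ∫ z, ∫ v in stdCube n 1, g (z + ε • R v) * (halfSign i v * η z) =
      ε * ∫ y, g y * cubeDiff i R η ε y := by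
  have hI := integrable_mul_halfSign_mul hg hη hηc i R hε hε1
  have hJ := integrable_shear_halfSign_mul hg hη hηc i R hε hε1
  have hmp := measurePreserving_shear R ε (volume.restrict (stdCube n 1))
  have h1 := integral_prod_symm _ hJ
  have h2 := integral_prod_symm _ hI
  have h3 := integral_map hmp.measurable.aemeasurable (hmp.map_eq.symm ▸ hI.aestronglyMeasurable)
  rw [hmp.map_eq] at h3
  simp only [add_sub_cancel_right] at h3
  simp only at h1 h2
  rw [← h1, ← h3, h2, ← integral_const_mul]
  congr 1 with y
  rw [integral_const_mul, cubeDiff]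
  field_simp

end

/-- Lower bound of the energy by testing with functions supported in disjoint sets. -/
theorem sum_enorm_integral_mul_cubeDiff_le_K {g : 𝔼 n → ℝ} (hg : LocallyIntegrable g)
    {ι : Type*} [Fintype ι] {P : ι → Set (𝔼 n)} (hP : Pairwise (Function.onFun Disjoint P))
    {η : ι → 𝔼 n → ℝ} (hη : ∀ j, Continuous (η j)) (hηc : ∀ j, HasCompactSupport (η j))
    (hη1 : ∀ j z, |η j z| ≤ 1) (i : Fin n) (R : ι → 𝔼 n ≃ₗᵢ[ℝ] 𝔼 n) {ε : ℝ} (hε : 0 < ε)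
    (hε1 : ε ≤ 1)
    (hin : ∀ j z, η j z ≠ 0 → rigidMotion (R j) z '' stdCube n ε ⊆ P j) :
    ∑ j, ‖∫ y, g y * cubeDiff i (R j) (η j) ε y‖ₑ ≤ K n ε g := by
  set F : ι → 𝔼 n → ℝ≥0∞ := fun j z =>
    ‖∫ v in stdCube n 1, g (z + ε • R j v) * (halfSign i v * η j z)‖ₑ with hF
  have hFm : ∀ j, AEMeasurable (F j) := fun j =>
    (integrable_shear_halfSign_mul hg (hη j) (hηc j) i (R j) hε
      hε1).integral_prod_right.aestronglyMeasurable.enorm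
  have hFeq : ∀ j z, F j z =
      ENNReal.ofReal (|∫ v in stdCube n 1, halfSign i v * g (z + ε • R j v)| * |η j z|) := by
    intro j z
    rw [hF, ← abs_mul, ← integral_mul_const, ← Real.enorm_eq_ofReal_abs]
    refine congrArg enorm (integral_congr_ae (ae_of_all _ fun v => ?_))
    ring
  have hFle : ∀ j z, F j z ≤ ENNReal.ofReal (⨍ x in rigidMotion (R j) z '' stdCube n ε,
        |g x - ⨍ y in rigidMotion (R j) z '' stdCube n ε, g y|) := by
    intro j z
    rw [hFeq]
    refine ENNReal.ofReal_le_ofReal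
      (le_trans ?_ (abs_setIntegral_halfSign_mul_le hg i (R j) z hε))
    exact mul_le_of_le_one_right (abs_nonneg _) (hη1 j z)
  have hsum : ∀ t, ∑' k : Fin n → ℤ, ENNReal.ofReal (ε ^ (n - 1)) *
      ∑ j, F j (R j (t + latticePoint ε k)) ≤ K n ε g := by
    intro t
    set z : ι × (Fin n → ℤ) → 𝔼 n := fun p => R p.1 (t + latticePoint ε p.2) with hz
    set I : Set (ι × (Fin n → ℤ)) := {p | η p.1 (z p) ≠ 0} with hI
    have h1 : ∑' k : Fin n → ℤ, ∑ j, F j (R j (t + latticePoint ε k)) =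
        ∑' p : I, F (p : ι × (Fin n → ℤ)).1 (z p) := by
      rw [Summable.tsum_finsetSum fun _ _ => ENNReal.summable,
        tsum_subtype_eq_of_support_subset (f := fun p => F p.1 (z p)), ENNReal.tsum_prod',
        tsum_fintype]
      intro p hp h0
      refine hp ?_
      have h0 : η p.1 (z p) = 0 := h0
      simp only [hFeq, h0, abs_zero, mul_zero, ENNReal.ofReal_zero]
    rw [ENNReal.tsum_mul_left, h1]
    refine le_trans ?_ (K_ge_tsum hε g
      (fun p : I => rigidMotion (R p.1.1) (z p) '' stdCube n ε)
      (fun p => isCube_rigidMotion _ _ _) ?_)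
    · gcongr with p
      exact hFle _ _
    · rintro ⟨⟨j, k⟩, hp⟩ ⟨⟨j', k'⟩, hp'⟩ hne
      by_cases hj : j = j'
      · subst hj
        have hk : k ≠ k' := fun h => hne (by subst h; rfl)
        have := (disjoint_image_stdCube_latticePoint hε t hk)
        rw [← Set.disjoint_image_iff (R j).injective, Set.image_image, Set.image_image] at this
        have hset : ∀ l, rigidMotion (R j) (z (j, l)) '' stdCube n ε =
            (fun v => R j (t + latticePoint ε l + v)) '' stdCube n ε := fun l =>
          Set.image_congr fun v _ => by simp [hz]
        simpa only [Function.onFun, hset] using this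
      · exact (hP hj).mono (hin _ _ hp) (hin _ _ hp')
  have hav := lintegral_le_of_forall_tsum_latticePoint_le hε
    (F := fun t => ENNReal.ofReal (ε ^ (n - 1)) * ∑ j, F j (R j t)) (by
      refine AEMeasurable.const_mul (Finset.aemeasurable_fun_sum _ fun j _ => ?_) _
      exact (hFm j).comp_quasiMeasurePreserving (R j).measurePreserving.quasiMeasurePreserving)
    hsum
  have hFint : ∀ j, ENNReal.ofReal ε * ‖∫ y, g y * cubeDiff i (R j) (η j) ε y‖ₑ ≤
      ∫⁻ t, F j (R j t) := by
    intro j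
    have e : ∫⁻ t, F j (R j t) = ∫⁻ z, F j z :=
      (R j).measurePreserving.lintegral_comp_emb
        (R j).toHomeomorph.measurableEmbedding _
    rw [e, ← Real.enorm_of_nonneg hε.le, ← enorm_mul,
      ← integral_shear_halfSign_mul hg (hη j) (hηc j) i (R j) hε hε1]
    exact enorm_integral_le_lintegral_enorm _
  have hpow : ENNReal.ofReal (ε ^ n) = ENNReal.ofReal (ε ^ (n - 1)) * ENNReal.ofReal ε := by
    rw [← ENNReal.ofReal_mul (by positivity), ← pow_succ, Nat.sub_add_cancel i.pos]
  have hc0 : ENNReal.ofReal (ε ^ n) ≠ 0 := by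
    simpa using pow_pos hε n
  refine (ENNReal.mul_le_mul_iff_right hc0 ENNReal.ofReal_ne_top).1 (le_trans ?_ hav)
  rw [lintegral_const_mul' _ _ ENNReal.ofReal_ne_top, hpow, mul_assoc, Finset.mul_sum,
    lintegral_finsetSum']
  · gcongr with j
    exact hFint j
  · exact fun j _ => (hFm j).comp_quasiMeasurePreserving
      (R j).measurePreserving.quasiMeasurePreserving

end FineScale

section Limit

variable {n : ℕ}

theorem exists_linearIsometryEquiv_single (i : Fin n) {w : 𝔼 n} (hw : ‖w‖ ≤ 1) :
    ∃ (R : 𝔼 n ≃ₗᵢ[ℝ] 𝔼 n) (r : ℝ), |r| ≤ 1 ∧ w = r • R (EuclideanSpace.single i 1) := by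
  rcases eq_or_ne w 0 with rfl | h0
  · exact ⟨LinearIsometryEquiv.refl ℝ _, 0, by simp, by simp⟩
  have hν : ‖(‖w‖⁻¹ • w)‖ = 1 := norm_smul_inv_norm h0
  have ho : Orthonormal ℝ (Set.domRestrict ({i} : Set (Fin n)) fun _ => ‖w‖⁻¹ • w) := by
    refine ⟨fun _ => hν, fun a b hab => ?_⟩
    exact absurd (Subsingleton.elim a b) hab
  obtain ⟨b, hb⟩ := ho.exists_orthonormalBasis_extension_of_card_eq (by simp)
  refine ⟨b.repr.symm, ‖w‖, by simpa using hw, ?_⟩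
  rw [OrthonormalBasis.repr_symm_single, hb i rfl, smul_smul,
    mul_inv_cancel₀ (norm_ne_zero_iff.2 h0), one_smul]

section CubeDiff

variable {η : 𝔼 n → ℝ}

theorem integrableOn_halfSign_mul_comp (hη : Continuous η) (hηc : HasCompactSupport η) (i : Fin n)
    (R : 𝔼 n ≃ₗᵢ[ℝ] 𝔼 n) (ε : ℝ) (y : 𝔼 n) :
    IntegrableOn (fun v => halfSign i v * η (y - ε • R v)) (stdCube n 1) := by
  obtain ⟨M, hM⟩ := hηc.exists_bound_of_continuous hη
  refine (integrableOn_halfSign i).mul_bdd (c := M) ?_ (ae_of_all _ fun v => hM _)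
  have : Continuous fun v => η (y - ε • R v) := by fun_prop
  exact this.aestronglyMeasurable

theorem cubeDiff_eq (hη : Continuous η) (hηc : HasCompactSupport η) (i : Fin n)
    (R : 𝔼 n ≃ₗᵢ[ℝ] 𝔼 n) (ε : ℝ) (y : 𝔼 n) :
    cubeDiff i R η ε y =
      ∫ v in stdCube n 1, halfSign i v * (ε⁻¹ * (η (y + ε • (-R v)) - η y)) := by
  have h : ∀ v, halfSign i v * (ε⁻¹ * (η (y + ε • (-R v)) - η y)) =
      ε⁻¹ * (halfSign i v * η (y - ε • R v) - halfSign i v * η y) := fun v => by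
    rw [smul_neg, ← sub_eq_add_neg]; ring
  simp_rw [h]
  rw [integral_const_mul, integral_sub (integrableOn_halfSign_mul_comp hη hηc i R ε y)
    ((integrableOn_halfSign i).mul_const _), integral_mul_const, setIntegral_halfSign, zero_mul,
    sub_zero, cubeDiff]

theorem norm_halfSign_mul_slope_le {L : NNReal} (hL : LipschitzWith L η) (i : Fin n)
    (R : 𝔼 n ≃ₗᵢ[ℝ] 𝔼 n) {ε : ℝ} (hε : 0 < ε) (y : 𝔼 n) {v : 𝔼 n} (hv : v ∈ stdCube n 1) :
    ‖halfSign i v * (ε⁻¹ * (η (y + ε • (-R v)) - η y))‖ ≤ L * n := by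
  rw [norm_mul, norm_mul, Real.norm_eq_abs, abs_halfSign, one_mul, norm_inv,
    Real.norm_of_nonneg hε.le, inv_mul_le_iff₀ hε]
  have h := hL.dist_le_mul (y + ε • (-R v)) y
  rw [dist_eq_norm, dist_eq_norm, add_sub_cancel_left, norm_smul, Real.norm_of_nonneg hε.le,
    norm_neg, LinearIsometryEquiv.norm_map] at h
  have h2 := norm_le_of_mem_stdCube hv
  rw [mul_one] at h2
  calc _ ≤ L * (ε * ‖v‖) := h
    _ ≤ L * (ε * n) := by gcongr
    _ = _ := by ring

theorem abs_cubeDiff_le (hη : Continuous η) (hηc : HasCompactSupport η) {L : NNReal}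
    (hL : LipschitzWith L η) (i : Fin n) (R : 𝔼 n ≃ₗᵢ[ℝ] 𝔼 n) {ε : ℝ} (hε : 0 < ε) (y : 𝔼 n) :
    |cubeDiff i R η ε y| ≤ L * n := by
  rw [cubeDiff_eq hη hηc, ← Real.norm_eq_abs]
  refine (norm_integral_le_of_norm_le_const (C := L * n) ?_).trans_eq (by simp)
  filter_upwards [ae_restrict_mem (isOpen_stdCube n 1).measurableSet] with v hv
  exact norm_halfSign_mul_slope_le hL i R hε y hv

theorem cubeDiff_eq_zero (i : Fin n) (R : 𝔼 n ≃ₗᵢ[ℝ] 𝔼 n) {ε : ℝ} (hε : 0 < ε) (hε1 : ε ≤ 1)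
    {y : 𝔼 n} (hy : y ∉ Metric.cthickening n (tsupport η)) : cubeDiff i R η ε y = 0 := by
  rw [cubeDiff, setIntegral_congr_fun (g := fun _ => 0) (isOpen_stdCube n 1).measurableSet]
  · simp
  · intro v hv
    simp [comp_sub_smul_eq_zero R hε hε1 hv hy]

theorem aestronglyMeasurable_cubeDiff (hη : Continuous η) (hηc : HasCompactSupport η) (i : Fin n)
    (R : 𝔼 n ≃ₗᵢ[ℝ] 𝔼 n) {ε : ℝ} (hε : 0 < ε) (hε1 : ε ≤ 1) :
    AEStronglyMeasurable (cubeDiff i R η ε) volume := by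
  have := (integrable_mul_halfSign_mul (g := fun _ => 1) (locallyIntegrable_const 1) hη hηc i R
    hε hε1).integral_prod_right.aestronglyMeasurable
  simp only [one_mul] at this
  exact this.const_mul ε⁻¹

theorem tendsto_cubeDiff (hη : ContDiff ℝ 1 η) (hηc : HasCompactSupport η) (i : Fin n)
    (R : 𝔼 n ≃ₗᵢ[ℝ] 𝔼 n) (y : 𝔼 n) :
    Tendsto (fun ε => cubeDiff i R η ε y) (𝓝[>] 0)
      (𝓝 (-(1 / 4) * fderiv ℝ η y (R (EuclideanSpace.single i 1)))) := by
  obtain ⟨L, hL⟩ := hη.lipschitzWith_of_hasCompactSupport hηc one_ne_zero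
  have hlim : -(1 / 4) * fderiv ℝ η y (R (EuclideanSpace.single i 1)) =
      ∫ v in stdCube n 1, halfSign i v * fderiv ℝ η y (-R v) := by
    have hInt : Integrable (fun v => halfSign i v • v) (volume.restrict (stdCube n 1)) := by
      by_contra h
      have h1 := setIntegral_halfSign_smul i
      rw [integral_undef h] at h1
      have h2 := congrArg (fun x : 𝔼 n => x i) h1
      norm_num at h2
    have h := ((fderiv ℝ η y).comp
      (R.toContinuousLinearEquiv : 𝔼 n →L[ℝ] 𝔼 n)).integral_comp_comm hInt
    rw [setIntegral_halfSign_smul] at h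
    simp only [map_smul, smul_eq_mul, ContinuousLinearMap.comp_apply,
      ContinuousLinearEquiv.coe_coe, LinearIsometryEquiv.coe_toContinuousLinearEquiv] at h
    simp only [map_neg, mul_neg, integral_neg, h]
    ring
  rw [hlim]
  simp_rw [cubeDiff_eq hη.continuous hηc]
  refine tendsto_integral_filter_of_dominated_convergence (fun _ => (L * n : ℝ)) ?_ ?_
    (integrable_const _) ?_
  · refine Eventually.of_forall fun ε => Measurable.aestronglyMeasurable ?_
    have : Continuous fun v => ε⁻¹ * (η (y + ε • (-R v)) - η y) := by
      have := hη.continuous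
      fun_prop
    exact (measurable_halfSign i).mul this.measurable
  · filter_upwards [self_mem_nhdsWithin] with ε hε
    filter_upwards [ae_restrict_mem (isOpen_stdCube n 1).measurableSet] with v hv
    exact norm_halfSign_mul_slope_le hL i R hε y hv
  · refine ae_of_all _ fun v => ?_
    have hd := ((hη.differentiable one_ne_zero y).hasFDerivAt.hasLineDerivAt (-R v))
    exact hd.tendsto_slope_zero_right.const_mul _

/-- Passage to the limit in the pairing of `fε ε` with `cubeDiff`. -/
theorem tendsto_integral_mul_cubeDiff {f : 𝔼 n → ℝ} (hf : LocallyIntegrable f)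
    {fε : ℝ → 𝔼 n → ℝ} (hfε : ∀ ε : ℝ, 0 < ε → LocallyIntegrable (fε ε))
    (hconv : ∀ C : Set (𝔼 n), IsCompact C →
      Tendsto (fun ε => ∫ x in C, |fε ε x - f x|) (𝓝[>] (0 : ℝ)) (𝓝 0))
    (hη : ContDiff ℝ 1 η) (hηc : HasCompactSupport η) (i : Fin n) (R : 𝔼 n ≃ₗᵢ[ℝ] 𝔼 n) :
    Tendsto (fun ε => ∫ y, fε ε y * cubeDiff i R η ε y) (𝓝[>] 0)
      (𝓝 (∫ y, f y * (-(1 / 4) * fderiv ℝ η y (R (EuclideanSpace.single i 1))))) := by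
  obtain ⟨L, hL⟩ := hη.lipschitzWith_of_hasCompactSupport hηc one_ne_zero
  set C := Metric.cthickening n (tsupport η) with hCdef
  have hC : IsCompact C := hηc.isCompact.cthickening
  have hsmall : ∀ᶠ ε in 𝓝[>] (0 : ℝ), 0 < ε ∧ ε ≤ 1 := by
    filter_upwards [Ioo_mem_nhdsGT one_pos] with ε hε using ⟨hε.1, hε.2.le⟩
  have hbound : ∀ (h : 𝔼 n → ℝ) (ε : ℝ), 0 < ε → ε ≤ 1 → ∀ y,
      ‖h y * cubeDiff i R η ε y‖ ≤ C.indicator (fun x => |h x| * (L * n)) y := by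
    intro h ε hε hε1 y
    by_cases hy : y ∈ C
    · rw [Set.indicator_of_mem hy, norm_mul]
      exact mul_le_mul_of_nonneg_left (abs_cubeDiff_le hη.continuous hηc hL i R hε y)
        (abs_nonneg _)
    · rw [Set.indicator_of_notMem hy, cubeDiff_eq_zero i R hε hε1 hy, mul_zero, norm_zero]
  have hind : ∀ h : 𝔼 n → ℝ, LocallyIntegrable h →
      Integrable (C.indicator fun x => |h x| * (L * n)) := fun h hh =>
    (integrable_indicator_iff hC.measurableSet).2
      ((hh.integrableOn_isCompact hC).abs.mul_const _)
  have hmeas : ∀ (h : 𝔼 n → ℝ) (ε : ℝ), LocallyIntegrable h → 0 < ε → ε ≤ 1 →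
      AEStronglyMeasurable (fun y => h y * cubeDiff i R η ε y) := fun h ε hh hε hε1 =>
    hh.aestronglyMeasurable.mul (aestronglyMeasurable_cubeDiff hη.continuous hηc i R hε hε1)
  have hInt : ∀ (h : 𝔼 n → ℝ) (ε : ℝ), LocallyIntegrable h → 0 < ε → ε ≤ 1 →
      Integrable (fun y => h y * cubeDiff i R η ε y) := fun h ε hh hε hε1 =>
    (hind h hh).mono' (hmeas h ε hh hε hε1) (ae_of_all _ (hbound h ε hε hε1))
  have h1 : Tendsto (fun ε => ∫ y, f y * cubeDiff i R η ε y) (𝓝[>] 0)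
      (𝓝 (∫ y, f y * (-(1 / 4) * fderiv ℝ η y (R (EuclideanSpace.single i 1))))) := by
    refine tendsto_integral_filter_of_dominated_convergence _ ?_ ?_ (hind f hf) ?_
    · filter_upwards [hsmall] with ε hε using hmeas f ε hf hε.1 hε.2
    · filter_upwards [hsmall] with ε hε using ae_of_all _ (hbound f ε hε.1 hε.2)
    · exact ae_of_all _ fun y => (tendsto_cubeDiff hη hηc i R y).const_mul _
  have h2 : Tendsto (fun ε => ∫ y, (fε ε y - f y) * cubeDiff i R η ε y) (𝓝[>] 0) (𝓝 0) := by
    have hz : Tendsto (fun ε => (∫ x in C, |fε ε x - f x|) * (L * n)) (𝓝[>] (0 : ℝ)) (𝓝 0) := by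
      simpa using (hconv C hC).mul_const ((L : ℝ) * n)
    refine squeeze_zero_norm' ?_ hz
    filter_upwards [hsmall] with ε hε
    have hloc : LocallyIntegrable (fun x => fε ε x - f x) := (hfε ε hε.1).sub hf
    refine (norm_integral_le_of_norm_le (hind _ hloc)
      (ae_of_all _ (hbound _ ε hε.1 hε.2))).trans_eq ?_
    rw [integral_indicator hC.measurableSet, integral_mul_const]
  have h3 := h1.add h2
  rw [add_zero] at h3
  refine h3.congr' ?_
  filter_upwards [hsmall] with ε hε
  rw [← integral_add (hInt f ε hf hε.1 hε.2)
    (hInt (fun x => fε ε x - f x) ε ((hfε ε hε.1).sub hf) hε.1 hε.2)]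
  congr 1 with y
  ring

end CubeDiff

theorem eventually_image_rigidMotion_subset {η : 𝔼 n → ℝ} (hηc : HasCompactSupport η)
    {P : Set (𝔼 n)} (hP : IsOpen P) (hηP : tsupport η ⊆ P) (R : 𝔼 n ≃ₗᵢ[ℝ] 𝔼 n) :
    ∀ᶠ ε in 𝓝[>] (0 : ℝ), ∀ z, η z ≠ 0 → rigidMotion R z '' stdCube n ε ⊆ P := by
  obtain ⟨δ, hδ, hsub⟩ := hηc.isCompact.exists_thickening_subset_open hP hηP
  have ht : Tendsto (fun ε : ℝ => n * ε) (𝓝[>] 0) (𝓝 0) := by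
    have : Tendsto (fun ε : ℝ => n * ε) (𝓝 0) (𝓝 (n * 0)) :=
      (continuous_const.mul continuous_id).tendsto 0
    rw [mul_zero] at this
    exact this.mono_left nhdsWithin_le_nhds
  filter_upwards [ht.eventually (gt_mem_nhds hδ)] with ε hε z hz
  rintro _ ⟨v, hv, rfl⟩
  refine hsub (Metric.mem_thickening_iff.2 ⟨z, subset_tsupport _ hz, ?_⟩)
  rw [rigidMotion_apply, dist_eq_norm, add_sub_cancel_left, LinearIsometryEquiv.norm_map]
  exact (norm_le_of_mem_stdCube hv).trans_lt hε

theorem sum_enorm_integral_mul_fderiv_le {f : 𝔼 n → ℝ} (hf : LocallyIntegrable f)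
    {fε : ℝ → 𝔼 n → ℝ} (hfε : ∀ ε : ℝ, 0 < ε → LocallyIntegrable (fε ε))
    (hconv : ∀ C : Set (𝔼 n), IsCompact C →
      Tendsto (fun ε => ∫ x in C, |fε ε x - f x|) (𝓝[>] (0 : ℝ)) (𝓝 0))
    (i : Fin n) {ι : Type*} [Fintype ι] {P : ι → Set (𝔼 n)} (hPo : ∀ j, IsOpen (P j))
    (hP : Pairwise (Function.onFun Disjoint P)) {η : ι → 𝔼 n → ℝ}
    (hη : ∀ j, ContDiff ℝ 1 (η j)) (hηc : ∀ j, HasCompactSupport (η j))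
    (hηP : ∀ j, tsupport (η j) ⊆ P j) (hη1 : ∀ j z, |η j z| ≤ 1) (w : ι → 𝔼 n)
    (hw : ∀ j, ‖w j‖ ≤ 1) :
    ∑ j, ‖∫ x, f x * fderiv ℝ (η j) x (w j)‖ₑ ≤
      4 * liminf (fun ε => K n ε (fε ε)) (𝓝[>] (0 : ℝ)) := by
  choose R r hr hwR using fun j => exists_linearIsometryEquiv_single i (hw j)
  set A : ι → ℝ := fun j =>
    ∫ y, f y * (-(1 / 4) * fderiv ℝ (η j) y (R j (EuclideanSpace.single i 1))) with hA
  have hlim : Tendsto (fun ε => ∑ j, ‖∫ y, fε ε y * cubeDiff i (R j) (η j) ε y‖ₑ) (𝓝[>] 0)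
      (𝓝 (∑ j, ‖A j‖ₑ)) :=
    tendsto_finsetSum _ fun j _ =>
      (tendsto_integral_mul_cubeDiff hf hfε hconv (hη j) (hηc j) i (R j)).enorm
  have hle : ∑ j, ‖A j‖ₑ ≤ liminf (fun ε => K n ε (fε ε)) (𝓝[>] (0 : ℝ)) := by
    rw [← hlim.liminf_eq]
    refine liminf_le_liminf ?_
    filter_upwards [Ioo_mem_nhdsGT one_pos, eventually_all.2 fun j =>
      eventually_image_rigidMotion_subset (hηc j) (hPo j) (hηP j) (R j)] with ε hε hin
    exact sum_enorm_integral_mul_cubeDiff_le_K (hfε ε hε.1) hP (fun j => (hη j).continuous) hηc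
      hη1 i R hε.1 hε.2.le hin
  refine le_trans ?_ (mul_le_mul_right hle 4)
  rw [Finset.mul_sum]
  refine Finset.sum_le_sum fun j _ => ?_
  have h4 : ∫ x, f x * fderiv ℝ (η j) x (w j) = (-(4 * r j)) * A j := by
    rw [hA, ← integral_const_mul]
    congr 1 with x
    rw [hwR j, map_smul, smul_eq_mul]
    ring
  have h5 : (4 : ℝ≥0∞) = ‖(4 : ℝ)‖ₑ := by
    rw [Real.enorm_of_nonneg (by norm_num)]
    norm_num
  rw [h4, enorm_mul, h5]
  gcongr
  rw [enorm_le_iff_norm_le, norm_neg, norm_mul]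
  exact mul_le_of_le_one_right (norm_nonneg _) (hr j)

end Limit

section CoarseScale

variable {n : ℕ}

theorem continuous_div' {φ : 𝔼 n → 𝔼 n} (hφ : ContDiff ℝ 1 φ) : Continuous (div' φ) := by
  have := hφ.continuous_fderiv one_ne_zero
  unfold div'
  fun_prop

theorem hasCompactSupport_div' {φ : 𝔼 n → 𝔼 n} (hφc : HasCompactSupport φ) :
    HasCompactSupport (div' φ) := by
  refine (hφc.fderiv ℝ).mono fun x hx h0 => hx ?_
  have h0 : fderiv ℝ φ x = 0 := h0
  simp [div', h0]

theorem integral_fderiv_apply_eq_integral_mul_div' {η : 𝔼 n → ℝ} (hη : ContDiff ℝ 1 η)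
    (hηc : HasCompactSupport η) {φ : 𝔼 n → 𝔼 n} (hφ : ContDiff ℝ 1 φ) (x : 𝔼 n) :
    ∫ y, fderiv ℝ η (x - y) (φ y) = ∫ y, η (x - y) * div' φ y := by
  set ψ : 𝔼 n → ℝ := fun y => η (x - y) with hψ
  have hψ1 : ContDiff ℝ 1 ψ := hη.comp (contDiff_const.sub contDiff_id)
  have hψc : HasCompactSupport ψ := hηc.comp_homeomorph (Homeomorph.subLeft x)
  have hψd : ∀ y v, fderiv ℝ ψ y v = -fderiv ℝ η (x - y) v := by
    intro y v
    have h := (hη.differentiable one_ne_zero (x - y)).hasFDerivAt.comp y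
      ((hasFDerivAt_id y).const_sub x)
    have h2 : fderiv ℝ ψ y = _ := h.fderiv
    rw [h2]
    simp
  set e : Fin n → 𝔼 n := fun i => EuclideanSpace.single i 1 with he
  have hu : ∀ i, ContDiff ℝ 1 fun y => φ y i := fun i => by fun_prop
  have hud : ∀ i y, fderiv ℝ (fun y => φ y i) y (e i) = fderiv ℝ φ y (e i) i := by
    intro i y
    have h := (EuclideanSpace.proj i : 𝔼 n →L[ℝ] ℝ).hasFDerivAt.comp y
      (hφ.differentiable one_ne_zero y).hasFDerivAt
    have h2 : fderiv ℝ (fun y => φ y i) y = _ := h.fderiv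
    rw [h2]
    simp
  have hψf : Continuous (fderiv ℝ ψ) := hψ1.continuous_fderiv one_ne_zero
  have huf : ∀ i, Continuous (fderiv ℝ fun y => φ y i) := fun i =>
    (hu i).continuous_fderiv one_ne_zero
  have hψcont := hψ1.continuous
  have i1 : ∀ i, Integrable fun y => fderiv ℝ ψ y (e i) * φ y i := fun i =>
    Continuous.integrable_of_hasCompactSupport
      ((hψf.clm_apply continuous_const).mul (hu i).continuous)
      (((hψc.fderiv_apply ℝ (e i))).mul_right)
  have i2 : ∀ i, Integrable fun y => ψ y * fderiv ℝ (fun y => φ y i) y (e i) := fun i =>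
    Continuous.integrable_of_hasCompactSupport
      (hψcont.mul ((huf i).clm_apply continuous_const)) hψc.mul_right
  have i3 : ∀ i, Integrable fun y => ψ y * φ y i := fun i =>
    Continuous.integrable_of_hasCompactSupport (hψcont.mul (hu i).continuous) hψc.mul_right
  have hparts := fun i => integral_mul_fderiv_eq_neg_fderiv_mul_of_integrable (i1 i) (i2 i) (i3 i)
    (fun y _ => hψ1.differentiable one_ne_zero y) (fun y _ => (hu i).differentiable one_ne_zero y)
  have hL : ∀ y, fderiv ℝ η (x - y) (φ y) = ∑ i, -(fderiv ℝ ψ y (e i) * φ y i) := by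
    intro y
    have hφy : φ y = ∑ i, φ y i • e i := by
      ext j
      simp [he, Pi.single_apply]
    conv_lhs => rw [hφy]
    simp only [map_sum, map_smul, smul_eq_mul, hψd]
    exact Finset.sum_congr rfl fun i _ => by ring
  have hRr : ∀ y, η (x - y) * div' φ y = ∑ i, ψ y * fderiv ℝ (fun y => φ y i) y (e i) := by
    intro y
    simp only [hud]
    simp only [div', Finset.mul_sum, hψ, he]
  simp_rw [hL, hRr]
  have i4 : ∀ i, Integrable fun y => -(fderiv ℝ ψ y (e i) * φ y i) := fun i => (i1 i).neg
  rw [integral_finsetSum _ fun i _ => i4 i, integral_finsetSum _ fun i _ => i2 i]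
  refine Finset.sum_congr rfl fun i _ => ?_
  rw [hparts i, integral_neg]

/-- Estimate on a single coarse scale `δ`, obtained by averaging over the translates of the grid
of cubes of side `δ`. -/
theorem enorm_integral_mul_integral_div'_le {f : 𝔼 n → ℝ} (hf : LocallyIntegrable f)
    {B : ℝ≥0∞} {δ : ℝ} (hδ : 0 < δ) {η : 𝔼 n → ℝ} (hη : ContDiff ℝ 1 η)
    (hηc : HasCompactSupport η) {φ : 𝔼 n → 𝔼 n}
    (hφ : ContDiff ℝ 1 φ) (hφc : HasCompactSupport φ)
    (hB : ∀ (t : 𝔼 n) (J : Finset (Fin n → ℤ)), ∑ k ∈ J,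
      ‖∫ x, f x * fderiv ℝ η (x - (t + latticePoint δ k)) (φ (t + latticePoint δ k))‖ₑ ≤ B) :
    ‖∫ x, f x * ∫ z, η z * div' φ (x - z)‖ₑ ≤ ENNReal.ofReal (δ ^ n) * B := by
  set A : 𝔼 n → ℝ := fun y => ∫ x, f x * fderiv ℝ η (x - y) (φ y) with hA
  set S := tsupport φ with hS
  have hSc : IsCompact S := hφc
  have : IsFiniteMeasure (volume.restrict S) := ⟨by simpa using hSc.measure_lt_top⟩
  have hφ0 : ∀ y ∉ S, φ y = 0 := fun y hy => image_eq_zero_of_notMem_tsupport hy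
  have hηf := hη.continuous_fderiv one_ne_zero
  have hφcont := hφ.continuous
  obtain ⟨M, hM⟩ := (hηc.fderiv ℝ).exists_bound_of_continuous hηf
  obtain ⟨N, hN⟩ := hφc.exists_bound_of_continuous hφcont
  have hM0 : 0 ≤ M := (norm_nonneg _).trans (hM 0)
  have hInt : Integrable (fun p : 𝔼 n × 𝔼 n => f p.2 * fderiv ℝ η (p.2 - p.1) (φ p.1))
      ((volume.restrict S).prod volume) := by
    refine integrable_prod_mul_of_bounded hf (M := M * N)
      (B := fun p => fderiv ℝ η (p.2 - p.1) (φ p.1)) ?_ ?_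
      ((hηc.fderiv ℝ).isCompact.add hSc) ?_
    · have : Continuous fun p : 𝔼 n × 𝔼 n => fderiv ℝ η (p.2 - p.1) (φ p.1) := by fun_prop
      exact this.aestronglyMeasurable
    · intro p
      refine ((fderiv ℝ η (p.2 - p.1)).le_opNorm (φ p.1)).trans ?_
      exact mul_le_mul (hM _) (hN _) (norm_nonneg _) hM0
    · filter_upwards [ae_restrict_mem hSc.measurableSet] with y hy x hx
      have : fderiv ℝ η (x - y) = 0 := by
        refine image_eq_zero_of_notMem_tsupport fun h => hx ?_
        simpa using Set.add_mem_add h hy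
      simp [this]
  have hA0 : ∀ y ∉ S, A y = 0 := fun y hy => by simp [hA, hφ0 y hy]
  have hAind : S.indicator A = A := Set.indicator_eq_self.2 fun y hy => by
    by_contra h
    exact hy (hA0 y h)
  have hAm : AEMeasurable (fun y => ‖A y‖ₑ) := by
    have h := hInt.integral_prod_left.aestronglyMeasurable
    have h2 : AEStronglyMeasurable A volume := by
      rw [← hAind]
      exact (aestronglyMeasurable_indicator_iff hSc.measurableSet).2 h
    exact h2.enorm
  have hlat := lintegral_le_of_forall_tsum_latticePoint_le hδ hAm (B := B) fun t => by
    rw [ENNReal.tsum_eq_iSup_sum]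
    exact iSup_le fun J => hB t J
  have hAeq : ∫ y, A y = ∫ x, f x * ∫ z, η z * div' φ (x - z) := by
    calc ∫ y, A y = ∫ y in S, A y := (setIntegral_eq_integral_of_forall_compl_eq_zero hA0).symm
      _ = ∫ x, ∫ y in S, f x * fderiv ℝ η (x - y) (φ y) := integral_integral_swap hInt
      _ = ∫ x, f x * ∫ z, η z * div' φ (x - z) := by
        congr 1 with x
        rw [integral_const_mul, setIntegral_eq_integral_of_forall_compl_eq_zero
          (fun y hy => by simp [hφ0 y hy]),
          integral_fderiv_apply_eq_integral_mul_div' hη hηc hφ,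
          ← integral_sub_left_eq_self _ volume x]
        simp
  rw [← hAeq]
  exact (enorm_integral_le_lintegral_enorm _).trans hlat

theorem exists_contDiff_tsupport_subset_stdCube (n : ℕ) {c : ℝ} (hc : c < 1) :
    ∃ χ : 𝔼 n → ℝ, ContDiff ℝ 1 χ ∧ tsupport χ ⊆ stdCube n 1 ∧ HasCompactSupport χ ∧
      (∀ x, χ x ∈ Set.Icc 0 1) ∧ c ≤ ∫ x, χ x := by
  have hU := isOpen_stdCube n 1
  obtain ⟨T, hTU, hT, hcT⟩ := hU.exists_lt_isCompact (μ := volume) (r := ENNReal.ofReal c) (by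
    rw [volume_stdCube n one_pos, one_pow]
    exact (ENNReal.ofReal_lt_ofReal_iff one_pos).2 hc)
  obtain ⟨χ, h0, h1, hχ⟩ := exists_contMDiffMap_zero_one_nhds_of_isClosed (n := 1)
    (modelWithCornersSelf ℝ (𝔼 n)) hU.isClosed_compl hT.isClosed
    (Set.disjoint_compl_left_iff_subset.2 hTU)
  have hsupp : tsupport χ ⊆ stdCube n 1 := by
    intro x hx
    by_contra hxU
    refine notMem_tsupport_iff_eventuallyEq.2 ?_ hx
    exact h0.filter_mono (nhds_le_nhdsSet hxU)
  have hχc : HasCompactSupport χ := by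
    refine HasCompactSupport.of_support_subset_isCompact
      (isCompact_closedBall (0 : 𝔼 n) (n * 1)) fun x hx => ?_
    simpa using norm_le_of_mem_stdCube (hsupp (subset_tsupport _ hx))
  have hχs : ContDiff ℝ 1 χ := contMDiff_iff_contDiff.1 χ.contMDiff
  refine ⟨χ, hχs, hsupp, hχc, hχ, ?_⟩
  have hTfin : volume T ≠ ∞ := hT.measure_lt_top.ne
  calc c ≤ volume.real T := by
        rw [Measure.real]
        exact (ENNReal.ofReal_le_iff_le_toReal hTfin).1 hcT.le
    _ = ∫ x, T.indicator (fun _ => (1 : ℝ)) x := by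
        rw [integral_indicator hT.measurableSet]; simp
    _ ≤ ∫ x, χ x := by
        refine integral_mono ((integrable_indicator_iff hT.measurableSet).2
          (integrableOn_const hTfin)) (hχs.continuous.integrable_of_hasCompactSupport hχc) ?_
        intro x
        by_cases hx : x ∈ T
        · rw [Set.indicator_of_mem hx, h1.self_of_nhdsSet x hx]
        · rw [Set.indicator_of_notMem hx]
          exact (hχ x).1

theorem tendsto_integral_mul_integral_comp_sub_smul {f : 𝔼 n → ℝ} (hf : LocallyIntegrable f)
    {χ : 𝔼 n → ℝ} (hχ : Continuous χ) (hχc : HasCompactSupport χ)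
    (hχU : tsupport χ ⊆ stdCube n 1) {D : 𝔼 n → ℝ} (hD : Continuous D)
    (hDc : HasCompactSupport D) :
    Tendsto (fun δ : ℝ => ∫ x, f x * ∫ u, χ u * D (x - δ • u)) (𝓝[>] 0)
      (𝓝 (∫ x, f x * ((∫ u, χ u) * D x))) := by
  obtain ⟨M, hM⟩ := hDc.exists_bound_of_continuous hD
  have hχi : Integrable χ := hχ.integrable_of_hasCompactSupport hχc
  set C := Metric.cthickening n (tsupport D) with hCdef
  have hC : IsCompact C := hDc.isCompact.cthickening
  have hsmall : ∀ᶠ ε in 𝓝[>] (0 : ℝ), 0 < ε ∧ ε ≤ 1 := by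
    filter_upwards [Ioo_mem_nhdsGT one_pos] with ε hε using ⟨hε.1, hε.2.le⟩
  have hMχ : ∀ (δ : ℝ) (x u : 𝔼 n), ‖χ u * D (x - δ • u)‖ ≤ ‖χ u‖ * M := fun δ x u => by
    rw [norm_mul]
    exact mul_le_mul_of_nonneg_left (hM _) (norm_nonneg _)
  have hcont : ∀ δ : ℝ, Continuous fun x => ∫ u, χ u * D (x - δ • u) := fun δ =>
    continuous_of_dominated (bound := fun u => ‖χ u‖ * M)
      (fun x => Continuous.aestronglyMeasurable (by fun_prop))
      (fun x => ae_of_all _ (hMχ δ x)) (hχi.norm.mul_const M)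
      (ae_of_all _ fun u => by fun_prop)
  refine tendsto_integral_filter_of_dominated_convergence
    (C.indicator fun x => |f x| * ∫ u, ‖χ u‖ * M) ?_ ?_ ?_ ?_
  · exact Eventually.of_forall fun δ => hf.aestronglyMeasurable.mul (hcont δ).aestronglyMeasurable
  · filter_upwards [hsmall] with δ hδ
    refine ae_of_all _ fun x => ?_
    by_cases hx : x ∈ C
    · rw [Set.indicator_of_mem hx, norm_mul]
      exact mul_le_mul_of_nonneg_left (norm_integral_le_of_norm_le (hχi.norm.mul_const M)
        (ae_of_all _ (hMχ δ x))) (abs_nonneg _)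
    · have h0 : ∀ u, χ u * D (x - δ • u) = 0 := fun u => by
        by_cases hu : u ∈ stdCube n 1
        · have := comp_sub_smul_eq_zero (LinearIsometryEquiv.refl ℝ (𝔼 n)) hδ.1 hδ.2 hu hx
          rw [LinearIsometryEquiv.coe_refl, id] at this
          rw [this, mul_zero]
        · rw [image_eq_zero_of_notMem_tsupport fun h => hu (hχU h), zero_mul]
      simp [h0, Set.indicator_of_notMem hx]
  · exact (integrable_indicator_iff hC.measurableSet).2
      ((hf.integrableOn_isCompact hC).abs.mul_const _)
  · refine ae_of_all _ fun x => Tendsto.const_mul _ ?_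
    rw [← integral_mul_const]
    refine tendsto_integral_filter_of_dominated_convergence (fun u => ‖χ u‖ * M) ?_ ?_
      (hχi.norm.mul_const M) ?_
    · exact Eventually.of_forall fun δ => Continuous.aestronglyMeasurable (by fun_prop)
    · exact Eventually.of_forall fun δ => ae_of_all _ (hMχ δ x)
    · refine ae_of_all _ fun u => Tendsto.const_mul _ ?_
      have : Continuous fun δ : ℝ => D (x - δ • u) := by fun_prop
      have h := this.tendsto 0
      simp only [zero_smul, sub_zero] at h
      exact h.mono_left nhdsWithin_le_nhds

theorem enorm_integral_mul_div'_le {f : 𝔼 n → ℝ} (hf : LocallyIntegrable f)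
    {fε : ℝ → 𝔼 n → ℝ} (hfε : ∀ ε : ℝ, 0 < ε → LocallyIntegrable (fε ε))
    (hconv : ∀ C : Set (𝔼 n), IsCompact C →
      Tendsto (fun ε => ∫ x in C, |fε ε x - f x|) (𝓝[>] (0 : ℝ)) (𝓝 0))
    (i : Fin n) {φ : 𝔼 n → 𝔼 n} (hφ : ContDiff ℝ 1 φ) (hφc : HasCompactSupport φ)
    (hφ1 : ∀ x, ‖φ x‖ ≤ 1) {χ : 𝔼 n → ℝ} (hχ : ContDiff ℝ 1 χ)
    (hχU : tsupport χ ⊆ stdCube n 1) (hχc : HasCompactSupport χ)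
    (hχ1 : ∀ x, χ x ∈ Set.Icc 0 1) :
    ‖∫ x, f x * ((∫ u, χ u) * div' φ x)‖ₑ ≤
      4 * liminf (fun ε => K n ε (fε ε)) (𝓝[>] (0 : ℝ)) := by
  refine le_of_tendsto (tendsto_integral_mul_integral_comp_sub_smul hf hχ.continuous hχc hχU
    (continuous_div' hφ) (hasCompactSupport_div' hφc)).enorm ?_
  filter_upwards [self_mem_nhdsWithin] with δ hδ
  have hδ : 0 < δ := hδ
  set η : 𝔼 n → ℝ := fun x => χ (δ⁻¹ • x) with hηdef
  have hη : ContDiff ℝ 1 η := hχ.comp (contDiff_const_smul _)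
  have hηc : HasCompactSupport η := hχc.comp_smul (inv_ne_zero hδ.ne')
  have hηU : tsupport η ⊆ stdCube n δ := by
    intro x hx
    have h := hχU (tsupport_comp_subset_preimage χ (continuous_const_smul δ⁻¹) hx)
    rwa [← smul_stdCube_one hδ, Set.mem_smul_set_iff_inv_smul_mem₀ hδ.ne']
  have hB : ∀ (t : 𝔼 n) (J : Finset (Fin n → ℤ)), ∑ k ∈ J,
      ‖∫ x, f x * fderiv ℝ η (x - (t + latticePoint δ k)) (φ (t + latticePoint δ k))‖ₑ ≤
      4 * liminf (fun ε => K n ε (fε ε)) (𝓝[>] (0 : ℝ)) := by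
    intro t J
    have h := sum_enorm_integral_mul_fderiv_le hf hfε hconv i (ι := J)
      (P := fun k => (fun v => t + latticePoint δ (k : Fin n → ℤ) + v) '' stdCube n δ)
      (fun k => (Homeomorph.addLeft (t + latticePoint δ (k : Fin n → ℤ))).isOpenMap _
        (isOpen_stdCube n δ))
      (fun k l hkl => disjoint_image_stdCube_latticePoint hδ t fun h => hkl (Subtype.ext h))
      (η := fun k x => η (x - (t + latticePoint δ (k : Fin n → ℤ))))
      (fun k => hη.comp (contDiff_id.sub contDiff_const))
      (fun k => hηc.comp_homeomorph (Homeomorph.subRight (t + latticePoint δ (k : Fin n → ℤ))))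
      (fun k x hx => ?_) (fun k z => ?_) (fun k => φ (t + latticePoint δ (k : Fin n → ℤ)))
      (fun k => hφ1 _)
    · simp_rw [fderiv_comp_sub] at h
      rwa [← Finset.sum_coe_sort]
    · have h := hηU (tsupport_comp_subset_preimage η
        (continuous_id.sub continuous_const) hx)
      exact ⟨_, h, by simp⟩
    · rw [abs_le]
      have := hχ1 (δ⁻¹ • (z - (t + latticePoint δ (k : Fin n → ℤ))))
      exact ⟨by linarith [this.1], this.2⟩
  have h := enorm_integral_mul_integral_div'_le hf hδ hη hηc hφ hφc hB
  have hscale : ∫ x, f x * ∫ z, η z * div' φ (x - z) =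
      δ ^ n * ∫ x, f x * ∫ u, χ u * div' φ (x - δ • u) := by
    rw [← integral_const_mul]
    congr 1 with x
    have h2 := Measure.integral_comp_inv_smul_of_nonneg (volume : Measure (𝔼 n))
      (fun u => χ u * div' φ (x - δ • u)) hδ.le
    simp only [smul_inv_smul₀ hδ.ne', finrank_euclideanSpace_fin, smul_eq_mul] at h2
    rw [hηdef, h2]
    ring
  rw [hscale, enorm_mul, Real.enorm_of_nonneg (by positivity)] at h
  refine (ENNReal.mul_le_mul_iff_right ?_ ENNReal.ofReal_ne_top).1 h
  simpa using pow_pos hδ n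

end CoarseScale

/-- Γ-liminf inequality: if `f_ε → f` in `L^1_loc(ℝ^n)` as `ε → 0⁺`, then
`(1/4)·|Df|(ℝ^n) ≤ liminf_{ε→0} K_ε(f_ε)`. -/
theorem stmt0 (n : ℕ) (hn : 1 ≤ n) (f : EuclideanSpace ℝ (Fin n) → ℝ)
    (hf : LocallyIntegrable f volume)
    (fε : ℝ → EuclideanSpace ℝ (Fin n) → ℝ)
    (hfε : ∀ ε : ℝ, 0 < ε → LocallyIntegrable (fε ε) volume)
    (hconv : ∀ C : Set (EuclideanSpace ℝ (Fin n)), IsCompact C →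
      Tendsto (fun ε => ∫ x in C, |fε ε x - f x|) (𝓝[>] (0 : ℝ)) (𝓝 0)) :
    totalVariation n f / 4 ≤ liminf (fun ε => K n ε (fε ε)) (𝓝[>] (0 : ℝ)) := by
  refine ENNReal.div_le_of_le_mul' ?_
  refine iSup_le fun φ => iSup_le fun hφ => iSup_le fun hφc => iSup_le fun hφ1 => ?_
  set I := ∫ x, f x * div' φ x with hI
  have hc : ∀ c : ℝ, 0 ≤ c → c < 1 → ENNReal.ofReal (c * I) ≤
      4 * liminf (fun ε => K n ε (fε ε)) (𝓝[>] (0 : ℝ)) := by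
    intro c hc0 hc1
    rcases le_or_gt I 0 with hI0 | hI0
    · rw [ENNReal.ofReal_of_nonpos (mul_nonpos_of_nonneg_of_nonpos hc0 hI0)]
      exact zero_le
    obtain ⟨χ, hχ, hχU, hχc, hχ1, hcχ⟩ := exists_contDiff_tsupport_subset_stdCube n hc1
    refine le_trans ?_ (enorm_integral_mul_div'_le hf hfε hconv ⟨0, hn⟩ hφ hφc hφ1 hχ hχU hχc hχ1)
    have e : ∫ x, f x * ((∫ u, χ u) * div' φ x) = (∫ u, χ u) * I := by
      rw [hI, ← integral_const_mul]
      congr 1 with x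
      ring
    rw [e, Real.enorm_of_nonneg (mul_nonneg (hc0.trans hcχ) hI0.le)]
    exact ENNReal.ofReal_le_ofReal (mul_le_mul_of_nonneg_right hcχ hI0.le)
  have ht : Tendsto (fun c : ℝ => ENNReal.ofReal (c * I)) (𝓝[<] 1) (𝓝 (ENNReal.ofReal I)) := by
    have h : Continuous fun c : ℝ => ENNReal.ofReal (c * I) :=
      ENNReal.continuous_ofReal.comp (continuous_id.mul continuous_const)
    have h1 := h.tendsto 1
    rw [one_mul] at h1
    exact h1.mono_left nhdsWithin_le_nhds
  refine le_of_tendsto ht ?_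
  filter_upwards [Ioo_mem_nhdsLT one_pos] with c hcI
  exact hc c hcI.1.le hcI.2
end
end

section
/- Let n = 1. For every f ∈ L^1_loc(ℝ) and every family (f_ε)_{ε>0} ⊂ L^1_loc(ℝ) such that f_ε → f in L^1_loc(ℝ) as ε → 0, one has (1/4)·|Df|(ℝ) ≤ liminf_{ε→0} K_ε(f_ε). -/
open MeasureTheory Filter Topology ENNReal

noncomputable section

/-- The BMO-type energy `K_ε(f)` on the real line: the supremum, over all countable families
`H` of pairwise disjoint open intervals of length `ε`, of `Σ_{I ∈ H} ⨍_I |f - ⨍_I f|`,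
valued in `[0,∞]`. -/
def K1 (ε : ℝ) (f : ℝ → ℝ) : ℝ≥0∞ :=
  ⨆ (H : Set (Set ℝ)) (_ : H.Countable)
    (_ : ∀ I ∈ H, ∃ a : ℝ, I = Set.Ioo a (a + ε)) (_ : H.Pairwise Disjoint),
    ∑' I : H, ENNReal.ofReal (⨍ x in (I : Set ℝ), |f x - ⨍ y in (I : Set ℝ), f y|)

/-- The extended total variation `|Df|(ℝ)`, valued in `[0,∞]`. -/
def totalVariation1 (f : ℝ → ℝ) : ℝ≥0∞ :=
  ⨆ (φ : ℝ → ℝ) (_ : ContDiff ℝ 1 φ) (_ : HasCompactSupport φ) (_ : ∀ x, |φ x| ≤ 1),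
    ENNReal.ofReal (∫ x, f x * deriv φ x)

/-- The interval `I_j^δ = ((j-1)δ, jδ)` induced by the lattice `δℤ`. -/
def Ilat (δ : ℝ) (j : ℤ) : Set ℝ := Set.Ioo (((j : ℝ) - 1) * δ) ((j : ℝ) * δ)

/-- The piecewise constant `δ`-approximation `w^δ` of `w`, equal on each interval `I_j^δ`
to the average of `w` over `I_j^δ`. -/
def pc1 (δ : ℝ) (w : ℝ → ℝ) (x : ℝ) : ℝ := ⨍ y in Ilat δ ⌈x / δ⌉, w y

lemma lintegral_shift_sub_Ioc_le {g : ℝ → ℝ} (hg : LocallyIntegrable g volume) {δ : ℝ}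
    (hδ : 0 < δ) (a : ℝ) :
    ∫⁻ x in Set.Ioc a (a + δ), ‖g (x + δ) - g x‖ₑ ≤ ENNReal.ofReal (2 * δ) *
      ENNReal.ofReal (⨍ x in Set.Ioo a (a + 2 * δ),
        |g x - ⨍ y in Set.Ioo a (a + 2 * δ), g y|) := by
  set m := ⨍ y in Set.Ioo a (a + 2 * δ), g y
  have hgm : AEMeasurable (fun x => ‖g x - m‖ₑ) volume :=
    (hg.aestronglyMeasurable.aemeasurable.sub_const m).enorm
  have hint : IntegrableOn (fun x => g x - m) (Set.Ioo a (a + 2 * δ)) :=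
    ((hg.integrableOn_isCompact isCompact_Icc).mono_set Set.Ioo_subset_Icc_self).sub
      (integrableOn_const (measure_Ioo_lt_top.ne))
  have hshift : ∫⁻ x in Set.Ioc a (a + δ), ‖g (x + δ) - m‖ₑ =
      ∫⁻ x in Set.Ioc (a + δ) (a + 2 * δ), ‖g x - m‖ₑ := by
    have h := (measurePreserving_add_right (volume : Measure ℝ) δ).setLIntegral_comp_preimage_emb
      (measurableEmbedding_addRight δ) (fun x => ‖g x - m‖ₑ) (Set.Ioc (a + δ) (a + 2 * δ))
    rw [← h, Set.preimage_add_const_Ioc]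
    congr 3 <;> ring_nf
  have hrhs : ENNReal.ofReal (2 * δ) * ENNReal.ofReal (⨍ x in Set.Ioo a (a + 2 * δ), |g x - m|) =
      ∫⁻ x in Set.Ioc a (a + 2 * δ), ‖g x - m‖ₑ := by
    rw [← ENNReal.ofReal_mul (by positivity), setAverage_eq, Measure.real, Real.volume_Ioo,
      ENNReal.toReal_ofReal (by linarith), smul_eq_mul, add_sub_cancel_left,
      mul_inv_cancel_left₀ (by positivity), setLIntegral_congr Ioo_ae_eq_Ioc.symm]
    exact ofReal_integral_norm_eq_lintegral_enorm hint
  rw [hrhs]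
  calc ∫⁻ x in Set.Ioc a (a + δ), ‖g (x + δ) - g x‖ₑ
      ≤ ∫⁻ x in Set.Ioc a (a + δ), (‖g (x + δ) - m‖ₑ + ‖g x - m‖ₑ) := by
        refine lintegral_mono fun x => ?_
        rw [← sub_sub_sub_cancel_right _ _ m]
        exact enorm_sub_le
    _ = (∫⁻ x in Set.Ioc a (a + δ), ‖g x - m‖ₑ) +
        ∫⁻ x in Set.Ioc (a + δ) (a + 2 * δ), ‖g x - m‖ₑ := by
        rw [lintegral_add_right' _ hgm.restrict, hshift, add_comm]
    _ = ∫⁻ x in Set.Ioc a (a + 2 * δ), ‖g x - m‖ₑ := by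
        rw [← Set.Ioc_union_Ioc_eq_Ioc (show a ≤ a + δ by linarith)
            (show a + δ ≤ a + 2 * δ by linarith),
          lintegral_union measurableSet_Ioc (Set.Ioc_disjoint_Ioc_of_le le_rfl)]

lemma tsum_average_lattice_le_K1 {ε : ℝ} (hε : 0 < ε) (g : ℝ → ℝ) (c : ℝ) :
    ∑' k : ℤ, ENNReal.ofReal (⨍ x in Set.Ioo (c + k • ε) (c + k • ε + ε),
      |g x - ⨍ y in Set.Ioo (c + k • ε) (c + k • ε + ε), g y|) ≤ K1 ε g := by
  set I : ℤ → Set ℝ := fun k => Set.Ioo (c + k • ε) (c + k • ε + ε) with hI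
  have hdisj : Pairwise (Function.onFun Disjoint I) := by
    have h := Set.pairwise_disjoint_Ioo_add_zsmul c ε
    refine fun i j hij => ?_
    have := h hij
    simpa only [Function.onFun, hI, add_zsmul, one_zsmul, add_assoc] using this
  have hinj : Function.Injective I := by
    intro i j hij
    by_contra hne
    have h := hdisj hne
    rw [Function.onFun, hij, disjoint_self] at h
    exact (Set.nonempty_Ioo.2 (by linarith : c + j • ε < c + j • ε + ε)).ne_empty h
  have hsum := tsum_range (g := I) (fun J : Set ℝ =>
    ENNReal.ofReal (⨍ x in J, |g x - ⨍ y in J, g y|)) hinj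
  rw [← hsum]
  refine le_iSup_of_le (Set.range I) (le_iSup_of_le (Set.countable_range I)
    (le_iSup_of_le ?_ (le_iSup_of_le ?_ le_rfl)))
  · rintro _ ⟨k, rfl⟩
    exact ⟨_, rfl⟩
  · rintro _ ⟨i, rfl⟩ _ ⟨j, rfl⟩ hne
    exact hdisj fun h => hne (h ▸ rfl)

lemma lintegral_shift_sub_le {g : ℝ → ℝ} (hg : LocallyIntegrable g volume) {δ : ℝ}
    (hδ : 0 < δ) :
    ∫⁻ x, ‖g (x + δ) - g x‖ₑ ≤ ENNReal.ofReal δ * (4 * K1 (2 * δ) g) := by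
  have key : ∀ c : ℝ, ∑' k : ℤ, ∫⁻ x in Set.Ioc (c + k • (2 * δ)) (c + k • (2 * δ) + δ),
      ‖g (x + δ) - g x‖ₑ ≤ ENNReal.ofReal (2 * δ) * K1 (2 * δ) g := fun c =>
    calc _ ≤ ∑' k : ℤ, ENNReal.ofReal (2 * δ) * _ :=
          ENNReal.tsum_le_tsum fun k => lintegral_shift_sub_Ioc_le hg hδ (c + k • (2 * δ))
      _ ≤ _ := by
          rw [ENNReal.tsum_mul_left]
          gcongr
          exact tsum_average_lattice_le_K1 (by positivity) g c
  have hsplit : ∀ k : ℤ, ∫⁻ x in Set.Ioc (k • (2 * δ)) ((k + 1) • (2 * δ)), ‖g (x + δ) - g x‖ₑ =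
      (∫⁻ x in Set.Ioc (0 + k • (2 * δ)) (0 + k • (2 * δ) + δ), ‖g (x + δ) - g x‖ₑ) +
      ∫⁻ x in Set.Ioc (δ + k • (2 * δ)) (δ + k • (2 * δ) + δ), ‖g (x + δ) - g x‖ₑ := by
    intro k
    rw [show δ + k • (2 * δ) = 0 + k • (2 * δ) + δ by ring,
      ← lintegral_union measurableSet_Ioc (Set.Ioc_disjoint_Ioc_of_le le_rfl),
      Set.Ioc_union_Ioc_eq_Ioc (by linarith) (by linarith), add_zsmul, one_zsmul]
    congr 3 <;> ring
  rw [← setLIntegral_univ, ← iUnion_Ioc_zsmul (show 0 < 2 * δ by positivity),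
    lintegral_iUnion (fun _ => measurableSet_Ioc) (Set.pairwise_disjoint_Ioc_zsmul _),
    tsum_congr hsplit, ENNReal.tsum_add]
  refine (add_le_add (key 0) (key δ)).trans_eq ?_
  rw [ENNReal.ofReal_mul zero_le_two, ENNReal.ofReal_ofNat]
  ring

lemma ofReal_integral_mul_diffQuot_le_K1 {g φ : ℝ → ℝ} (hg : LocallyIntegrable g volume)
    (hφ : Continuous φ) (hsupp : HasCompactSupport φ) (hbd : ∀ x, |φ x| ≤ 1) {δ : ℝ}
    (hδ : 0 < δ) :
    ENNReal.ofReal (∫ x, g x * ((φ x - φ (x - δ)) / δ)) / 4 ≤ K1 (2 * δ) g := by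
  have h₁ : Integrable fun x => g x * φ x := by
    simpa [mul_comm] using hg.integrable_smul_left_of_hasCompactSupport hφ hsupp
  have h₂ : Integrable fun x => g x * φ (x - δ) := by
    simpa [mul_comm] using hg.integrable_smul_left_of_hasCompactSupport
      (hφ.comp (continuous_sub_right δ)) (hsupp.comp_homeomorph (Homeomorph.subRight δ))
  have h₃ : Integrable fun x => g (x + δ) * φ x := by
    simpa using h₂.comp_add_right δ
  have heq : ∫ x, g x * ((φ x - φ (x - δ)) / δ) = (∫ x, (g x - g (x + δ)) * φ x) / δ := by
    have hsh : ∫ x, g x * φ (x - δ) = ∫ x, g (x + δ) * φ x := by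
      simpa using (integral_add_right_eq_self (fun x => g x * φ (x - δ)) δ).symm
    simp_rw [← mul_div_assoc, integral_div, mul_sub, sub_mul]
    rw [integral_sub h₁ h₂, integral_sub h₁ h₃, hsh]
  have hle : ENNReal.ofReal (∫ x, (g x - g (x + δ)) * φ x) ≤
      ENNReal.ofReal δ * (4 * K1 (2 * δ) g) := by
    refine le_trans ?_ (lintegral_shift_sub_le hg hδ)
    refine (Real.ofReal_le_enorm _).trans ((enorm_integral_le_lintegral_enorm _).trans ?_)
    refine lintegral_mono fun x => ?_
    rw [enorm_mul, ← enorm_neg (g x - g (x + δ)), neg_sub]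
    refine mul_le_of_le_one_right' ?_
    rw [Real.enorm_eq_ofReal_abs]
    exact ENNReal.ofReal_le_one.2 (hbd x)
  rw [heq, ENNReal.ofReal_div_of_pos hδ]
  refine ENNReal.div_le_of_le_mul (ENNReal.div_le_of_le_mul (hle.trans_eq ?_))
  ring

lemma tendsto_integral_mul_diffQuot {f φ : ℝ → ℝ} (hf : LocallyIntegrable f volume)
    {fε : ℝ → ℝ → ℝ} (hfε : ∀ ε : ℝ, 0 < ε → LocallyIntegrable (fε ε) volume)
    (hconv : ∀ C : Set ℝ, IsCompact C →
      Tendsto (fun ε => ∫ x in C, |fε ε x - f x|) (𝓝[>] (0 : ℝ)) (𝓝 0))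
    (hφ : ContDiff ℝ 1 φ) (hsupp : HasCompactSupport φ) :
    Tendsto (fun ε => ∫ x, fε ε x * ((φ x - φ (x - ε / 2)) / (ε / 2))) (𝓝[>] (0 : ℝ))
      (𝓝 (∫ x, f x * deriv φ x)) := by
  obtain ⟨M, hM⟩ := hφ.lipschitzWith_of_hasCompactSupport hsupp one_ne_zero
  set C := Metric.cthickening 1 (tsupport φ)
  have hC : IsCompact C := hsupp.isCompact.cthickening
  set D : ℝ → ℝ → ℝ := fun ε x => (φ x - φ (x - ε / 2)) / (ε / 2)
  have hDcont : ∀ ε, Continuous (D ε) := fun ε =>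
    (hφ.continuous.sub (hφ.continuous.comp (continuous_sub_right _))).div_const _
  have hDbd : ∀ ε, 0 < ε → ∀ x, |D ε x| ≤ M := by
    intro ε hε x
    have h := hM.dist_le_mul x (x - ε / 2)
    rw [Real.dist_eq, Real.dist_eq, _root_.sub_sub_cancel, abs_of_pos (half_pos hε)] at h
    rw [abs_div, abs_of_pos (half_pos hε)]
    exact (div_le_iff₀ (half_pos hε)).2 h
  have hDsupp : ∀ ε, 0 < ε → ε < 1 → ∀ x, x ∉ C → D ε x = 0 := by
    intro ε hε hε1 x hx
    have hx1 : φ x = 0 := image_eq_zero_of_notMem_tsupport fun h =>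
      hx (Metric.self_subset_cthickening _ h)
    have hx2 : φ (x - ε / 2) = 0 := image_eq_zero_of_notMem_tsupport fun h =>
      hx (Metric.mem_cthickening_of_dist_le x _ 1 _ h (by
        rw [Real.dist_eq, _root_.sub_sub_cancel, abs_of_pos (half_pos hε)]; linarith))
    simp [D, hx1, hx2]
  have hDcs : ∀ ε, 0 < ε → ε < 1 → HasCompactSupport (D ε) := fun ε hε hε1 =>
    HasCompactSupport.intro hC (hDsupp ε hε hε1)
  have hsmall : ∀ᶠ ε : ℝ in 𝓝[>] 0, 0 < ε ∧ ε < 1 :=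
    Ioo_mem_nhdsGT one_pos
  have hDlim : ∀ x, Tendsto (fun ε => D ε x) (𝓝[>] 0) (𝓝 (deriv φ x)) := by
    intro x
    have hder : HasDerivAt φ (deriv φ x) x := (hφ.differentiable one_ne_zero x).hasDerivAt
    have ht : Tendsto (fun ε : ℝ => -(ε / 2)) (𝓝[>] 0) (𝓝[≠] 0) := by
      refine tendsto_nhdsWithin_iff.2 ⟨?_, ?_⟩
      · have : Continuous fun ε : ℝ => -(ε / 2) := by fun_prop
        simpa using (this.tendsto 0).mono_left nhdsWithin_le_nhds
      · filter_upwards [self_mem_nhdsWithin] with ε hε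
        simpa using (Set.mem_Ioi.1 hε).ne'
    refine (hder.tendsto_slope_zero.comp ht).congr fun ε => ?_
    simp only [Function.comp, smul_eq_mul, D, ← sub_eq_add_neg]
    rw [inv_neg, neg_mul, ← mul_neg, neg_sub, inv_mul_eq_div]
  have hlim : Tendsto (fun ε => ∫ x, f x * D ε x) (𝓝[>] 0) (𝓝 (∫ x, f x * deriv φ x)) := by
    refine tendsto_integral_filter_of_dominated_convergence (C.indicator fun x => |f x| * M)
      (Eventually.of_forall fun ε =>
        hf.aestronglyMeasurable.mul (hDcont ε).aestronglyMeasurable) ?_ ?_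
      (Eventually.of_forall fun x => (hDlim x).const_mul _)
    · filter_upwards [hsmall] with ε hε
      refine Eventually.of_forall fun x => ?_
      by_cases hx : x ∈ C
      · rw [Set.indicator_of_mem hx, Real.norm_eq_abs, abs_mul]
        exact mul_le_mul_of_nonneg_left (hDbd ε hε.1 x) (abs_nonneg _)
      · simp [hx, hDsupp ε hε.1 hε.2 x hx]
    · exact (integrable_indicator_iff hC.measurableSet).2
        ((hf.integrableOn_isCompact hC).abs.mul_const _)
  have hdiff : Tendsto (fun ε => ∫ x, (fε ε x - f x) * D ε x) (𝓝[>] 0) (𝓝 0) := by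
    refine squeeze_zero_norm' ?_ (by simpa using (hconv C hC).mul_const (M : ℝ))
    filter_upwards [hsmall] with ε hε
    have hint : IntegrableOn (fun x => |fε ε x - f x|) C :=
      (((hfε ε hε.1).sub hf).integrableOn_isCompact hC).abs
    rw [← setIntegral_eq_integral_of_forall_compl_eq_zero (s := C)
      (fun x hx => by rw [hDsupp ε hε.1 hε.2 x hx, mul_zero]), ← integral_mul_const]
    refine norm_integral_le_of_norm_le (hint.mul_const _) (Eventually.of_forall fun x => ?_)
    rw [Real.norm_eq_abs, abs_mul]
    exact mul_le_mul_of_nonneg_left (hDbd ε hε.1 x) (abs_nonneg _)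
  have hsum := hdiff.add hlim
  rw [zero_add] at hsum
  refine hsum.congr' ?_
  filter_upwards [hsmall] with ε hε
  have hi : ∀ {g : ℝ → ℝ}, LocallyIntegrable g volume → Integrable fun x => g x * D ε x :=
    fun hg => by
      simpa [mul_comm] using hg.integrable_smul_left_of_hasCompactSupport (hDcont ε)
        (hDcs ε hε.1 hε.2)
  refine (integral_add (hi ((hfε ε hε.1).sub hf)) (hi hf)).symm.trans ?_
  exact integral_congr_ae (Eventually.of_forall fun x => by simp only [D, Pi.sub_apply]; ring)

/-- One-dimensional Γ-liminf inequality: if `f_ε → f` in `L^1_loc(ℝ)` as `ε → 0⁺`, then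
`(1/4)·|Df|(ℝ) ≤ liminf_{ε→0} K_ε(f_ε)`. -/
theorem stmt3 (f : ℝ → ℝ) (hf : LocallyIntegrable f volume)
    (fε : ℝ → ℝ → ℝ)
    (hfε : ∀ ε : ℝ, 0 < ε → LocallyIntegrable (fε ε) volume)
    (hconv : ∀ C : Set ℝ, IsCompact C →
      Tendsto (fun ε => ∫ x in C, |fε ε x - f x|) (𝓝[>] (0 : ℝ)) (𝓝 0)) :
    totalVariation1 f / 4 ≤ liminf (fun ε => K1 ε (fε ε)) (𝓝[>] (0 : ℝ)) := by
  simp only [totalVariation1, ENNReal.iSup_div]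
  refine iSup_le fun φ => iSup_le fun hφ => iSup_le fun hsupp => iSup_le fun hbd => ?_
  have hlim := ENNReal.Tendsto.div_const (b := 4) (ENNReal.tendsto_ofReal
    (tendsto_integral_mul_diffQuot hf hfε hconv hφ hsupp)) (Or.inr (by norm_num))
  rw [← hlim.liminf_eq]
  refine liminf_le_liminf ?_
  filter_upwards [self_mem_nhdsWithin] with ε hε
  have h := ofReal_integral_mul_diffQuot_le_K1 (hfε ε hε) hφ.continuous hsupp hbd
    (half_pos (Set.mem_Ioi.1 hε))
  rwa [mul_div_cancel₀ ε two_ne_zero] at h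
end
end

section
/- Let w ∈ L^1_loc(ℝ) and δ > 0, and let w^δ be the piecewise constant δ-approximation of w. Then (1/4)·|Dw^δ|(ℝ) ≤ K_{2δ}(w). Equivalently, Σ_{j∈ℤ} |w_{I_j^δ} − w_{I_{j+1}^δ}| ≤ 4·K_{2δ}(w). -/
open MeasureTheory Filter Topology ENNReal

noncomputable section

/-- On two adjacent intervals of equal length, the difference of the averages is at most twice
the mean oscillation over their union. -/
theorem abs_average_sub_average_le_two_mul_oscillation {w : ℝ → ℝ}
    (hw : LocallyIntegrable w volume) {δ : ℝ} (hδ : 0 < δ) (a : ℝ) :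
    |(⨍ y in Set.Ioo a (a + δ), w y) - ⨍ y in Set.Ioo (a + δ) (a + 2 * δ), w y| ≤
      2 * ⨍ x in Set.Ioo a (a + 2 * δ), |w x - ⨍ y in Set.Ioo a (a + 2 * δ), w y| := by
  generalize (⨍ y in Set.Ioo a (a + 2 * δ), w y) = m
  have hwint (c d : ℝ) : IntegrableOn w (Set.Ioo c d) :=
    (hw.integrableOn_isCompact isCompact_Icc).mono_set Set.Ioo_subset_Icc_self
  have hm (c d : ℝ) : IntegrableOn (fun x ↦ w x - m) (Set.Ioo c d) :=
    (hwint c d).sub (integrableOn_const (by simp))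
  have hmean (c d : ℝ) (hcd : d - c = δ) :
      δ * |(⨍ y in Set.Ioo c d, w y) - m| ≤ ∫ x in Set.Ioo c d, |w x - m| := by
    have hvol : volume.real (Set.Ioo c d) = δ := by
      rw [Real.volume_real_Ioo_of_le (by linarith), hcd]
    have heq : δ * ((⨍ y in Set.Ioo c d, w y) - m) = ∫ x in Set.Ioo c d, (w x - m) := by
      rw [integral_sub (hwint c d) (integrableOn_const (by simp)), setIntegral_const, hvol,
        setAverage_eq, hvol, smul_eq_mul, smul_eq_mul]
      field_simp
    calc δ * |(⨍ y in Set.Ioo c d, w y) - m| = |∫ x in Set.Ioo c d, (w x - m)| := by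
          rw [← heq, abs_mul, abs_of_pos hδ]
      _ ≤ ∫ x in Set.Ioo c d, |w x - m| := abs_integral_le_integral_abs
  have hunion : (∫ x in Set.Ioo a (a + δ), |w x - m|) +
      (∫ x in Set.Ioo (a + δ) (a + 2 * δ), |w x - m|) ≤
        ∫ x in Set.Ioo a (a + 2 * δ), |w x - m| := by
    rw [← setIntegral_union (Set.disjoint_left.2 fun x hx hx' ↦ lt_asymm hx.2 hx'.1)
      measurableSet_Ioo (hm _ _).abs (hm _ _).abs]
    refine setIntegral_mono_set (hm _ _).abs (Eventually.of_forall fun x ↦ abs_nonneg _)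
      (LE.le.eventuallyLE (Set.union_subset ?_ ?_))
    · exact Set.Ioo_subset_Ioo_right (by linarith)
    · exact Set.Ioo_subset_Ioo_left (by linarith)
  have hleft := hmean a (a + δ) (by ring)
  have hright := hmean (a + δ) (a + 2 * δ) (by ring)
  rw [setAverage_eq _ (fun x ↦ |w x - m|), Real.volume_real_Ioo_of_le (by linarith), smul_eq_mul,
    show 2 * ((a + 2 * δ - a)⁻¹ * ∫ x in Set.Ioo a (a + 2 * δ), |w x - m|) =
      (∫ x in Set.Ioo a (a + 2 * δ), |w x - m|) / δ by
        rw [add_sub_cancel_left]; field_simp, le_div_iff₀ hδ]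
  have htri := abs_sub_le (⨍ y in Set.Ioo a (a + δ), w y) m
    (⨍ y in Set.Ioo (a + δ) (a + 2 * δ), w y)
  rw [abs_sub_comm m] at htri
  nlinarith [mul_le_mul_of_nonneg_left htri hδ.le]

/-- The mean oscillations over a family of intervals of length `ε` that tiles the line sum to at
most the BMO-type energy. -/
theorem tsum_oscillation_tiling_le_K1 (f : ℝ → ℝ) {ε : ℝ} (hε : 0 < ε) (b : ℝ) :
    ∑' k : ℤ, ENNReal.ofReal (⨍ x in Set.Ioo (b + k * ε) (b + k * ε + ε),
      |f x - ⨍ y in Set.Ioo (b + k * ε) (b + k * ε + ε), f y|) ≤ K1 ε f := by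
  set J : ℤ → Set ℝ := fun k ↦ Set.Ioo (b + k * ε) (b + k * ε + ε)
  have hdisj : Pairwise (Function.onFun Disjoint J) := by
    refine (pairwise_disjoint_on J).2 fun m n hmn ↦ Set.disjoint_left.2 fun x hx hx' ↦ ?_
    have hcast : (m : ℝ) + 1 ≤ n := by exact_mod_cast hmn
    nlinarith [hx.2, hx'.1, mul_le_mul_of_nonneg_right hcast hε.le]
  have hne (k : ℤ) : J k ≠ ∅ := (Set.nonempty_Ioo.2 (by linarith)).ne_empty
  have hinj : Function.Injective J := fun m n hmn ↦ by
    by_contra h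
    have hself : Disjoint (J m) (J n) := hdisj h
    rw [← hmn, disjoint_self] at hself
    exact hne m hself
  calc ∑' k : ℤ, ENNReal.ofReal (⨍ x in J k, |f x - ⨍ y in J k, f y|)
      = ∑' I : Set.range J,
          ENNReal.ofReal (⨍ x in (I : Set ℝ), |f x - ⨍ y in (I : Set ℝ), f y|) :=
        (tsum_range (fun I : Set ℝ ↦ ENNReal.ofReal (⨍ x in I, |f x - ⨍ y in I, f y|)) hinj).symm
    _ ≤ K1 ε f := by
        refine le_iSup₂_of_le (Set.range J) (Set.countable_range J)
          (le_iSup₂_of_le ?_ ?_ le_rfl)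
        · rintro _ ⟨k, rfl⟩
          exact ⟨_, rfl⟩
        · exact hdisj.range_pairwise

/-- A sum over `ℤ` splits into the sums over the even and over the odd integers. -/
theorem tsum_int_even_add_odd (F : ℤ → ℝ≥0∞) :
    ∑' j, F j = ∑' k : ℤ, F (2 * k) + ∑' k : ℤ, F (2 * k + 1) := by
  have heven : Function.Injective fun k : ℤ ↦ 2 * k := fun _ _ h ↦ by simpa using h
  have hodd : Function.Injective fun k : ℤ ↦ 2 * k + 1 := fun _ _ h ↦ by simpa using h
  have hcompl : IsCompl (Set.range fun k : ℤ ↦ 2 * k) (Set.range fun k : ℤ ↦ 2 * k + 1) := by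
    simpa using Int.isCompl_even_odd
  exact ((heven.hasSum_range_iff.2 ENNReal.summable.hasSum).add_isCompl hcompl
    (hodd.hasSum_range_iff.2 ENNReal.summable.hasSum)).tsum_eq

/-- The total variation of the piecewise constant approximation `w^δ`, namely
`Σ_{j∈ℤ} |w_{I_j^δ} - w_{I_{j+1}^δ}|`, is at most `4·K_{2δ}(w)`. -/
theorem stmt7 (w : ℝ → ℝ) (hw : LocallyIntegrable w volume) (δ : ℝ) (hδ : 0 < δ) :
    ∑' j : ℤ, ENNReal.ofReal |(⨍ y in Ilat δ j, w y) - ⨍ y in Ilat δ (j + 1), w y| ≤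
      4 * K1 (2 * δ) w := by
  set F : ℤ → ℝ≥0∞ :=
    fun j ↦ ENNReal.ofReal |(⨍ y in Ilat δ j, w y) - ⨍ y in Ilat δ (j + 1), w y| with hF
  have hparity (c : ℤ) : ∑' k : ℤ, F (2 * k + c) ≤ 2 * K1 (2 * δ) w := by
    refine le_trans ?_
      (mul_le_mul_right (tsum_oscillation_tiling_le_K1 w (by linarith : 0 < 2 * δ) ((c - 1) * δ)) 2)
    rw [← ENNReal.tsum_mul_left]
    refine ENNReal.tsum_le_tsum fun k ↦ ?_
    have hosc := abs_average_sub_average_le_two_mul_oscillation hw hδ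
      (((c : ℝ) - 1) * δ + k * (2 * δ))
    have hfst : Ilat δ (2 * k + c) = Set.Ioo (((c : ℝ) - 1) * δ + k * (2 * δ))
        (((c : ℝ) - 1) * δ + k * (2 * δ) + δ) := by
      unfold Ilat; congr 1 <;> push_cast <;> ring
    have hsnd : Ilat δ (2 * k + c + 1) = Set.Ioo (((c : ℝ) - 1) * δ + k * (2 * δ) + δ)
        (((c : ℝ) - 1) * δ + k * (2 * δ) + 2 * δ) := by
      unfold Ilat; congr 1 <;> push_cast <;> ring
    simp only [hF, hfst, hsnd]
    refine (ENNReal.ofReal_le_ofReal hosc).trans_eq ?_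
    rw [ENNReal.ofReal_mul zero_le_two, ENNReal.ofReal_ofNat]
  have hsplit : ∑' j, F j = ∑' k : ℤ, F (2 * k + 0) + ∑' k : ℤ, F (2 * k + 1) := by
    simp only [add_zero]
    exact tsum_int_even_add_odd F
  calc ∑' j, F j ≤ 2 * K1 (2 * δ) w + 2 * K1 (2 * δ) w :=
        hsplit.trans_le (add_le_add (hparity 0) (hparity 1))
    _ = 4 * K1 (2 * δ) w := by rw [← add_mul]; norm_num
end
end
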